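/- Let K ⊂ ℝ³ be a smooth, strictly convex body and α > 0. Suppose that for every p ∈ bd K there are two planes H₁, H₂, each containing the line through p with direction the outer unit normal η(p), forming an angle at least α with each other, such that bd K ∩ H₁ and bd K ∩ H₂ are ellipses. Then bd K is an ellipsoid. -/

import Mathlib

open scoped RealInnerProductSpace
open MeasureTheory

noncomputable section

/-- Euclidean 3-space. -/
abbrev E3 : Type := EuclideanSpace ℝ (Fin 3)

/-- The line through `p` with direction vector `v`. -/
def lineThrough (p v : E3) : Set E3 := {x : E3 | ∃ t : ℝ, x = p + t • v}

/-- A line in `ℝ³`. -/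
def IsLine (L : Set E3) : Prop := ∃ p v : E3, v ≠ 0 ∧ L = lineThrough p v

/-- A plane in `ℝ³` with prescribed unit normal `n`. -/
def IsPlaneWithNormal (H : Set E3) (n : E3) : Prop :=
  ‖n‖ = 1 ∧ ∃ c : ℝ, H = {x : E3 | ⟪n, x⟫ = c}

/-- A plane in `ℝ³`. -/
def IsPlane (H : Set E3) : Prop := ∃ n : E3, IsPlaneWithNormal H n

/-- The unit circle `{(cos t, sin t, 0)}` in the plane `z = 0`. -/
def unitCircle3 : Set E3 := {x : E3 | x 0 ^ 2 + x 1 ^ 2 = 1 ∧ x 2 = 0}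

/-- An ellipse in `ℝ³`: the image of the unit circle under an invertible affine map. -/
def IsEllipse (E : Set E3) : Prop := ∃ f : E3 ≃ᵃ[ℝ] E3, E = f '' unitCircle3

/-- An ellipsoid in `ℝ³`: the image of the unit sphere under an invertible affine map. -/
def IsEllipsoid (S : Set E3) : Prop := ∃ f : E3 ≃ᵃ[ℝ] E3, S = f '' Metric.sphere (0 : E3) 1

/-- A circle in `ℝ³`: the points of some plane at fixed positive distance from a
center lying in that plane. -/
def IsCircle (C : Set E3) : Prop :=
  ∃ (H : Set E3) (c : E3) (r : ℝ), IsPlane H ∧ c ∈ H ∧ 0 < r ∧ C = {x ∈ H | dist x c = r}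

/-- A sphere in `ℝ³`. -/
def IsSphere (S : Set E3) : Prop := ∃ (c : E3) (r : ℝ), 0 < r ∧ S = Metric.sphere c r

/-- A convex body: compact, convex, with nonempty interior. -/
def IsConvexBody (K : Set E3) : Prop := IsCompact K ∧ Convex ℝ K ∧ (interior K).Nonempty

/-- A line `L` is tangent to `bd K` if it meets `K` but not the interior of `K`. -/
def IsTangentLine (K L : Set E3) : Prop := (L ∩ K).Nonempty ∧ L ∩ interior K = ∅

/-- An outward function on the boundary of a convex body `K`. -/
def IsOutwardFunction (K : Set E3) (Ψ : E3 → E3) : Prop :=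
  ContinuousOn Ψ (frontier K) ∧
  ∀ p ∈ frontier K, ‖Ψ p‖ = 1 ∧
    ¬ IsTangentLine K (lineThrough p (Ψ p)) ∧
    (∀ t : ℝ, 0 < t → p + t • Ψ p ∉ K) ∧
    ∃ q ∈ frontier K, q ∉ lineThrough p (Ψ p) ∧
      (lineThrough p (Ψ p) ∩ lineThrough q (Ψ q) ∩ interior K).Nonempty

/-- `L` is a line parallel to the direction `u`. -/
def LineParallel (L : Set E3) (u : E3) : Prop := ∃ p : E3, L = lineThrough p u

/-- A system of lines: for every direction `u ∈ S²` exactly one member line parallel to `u`. -/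
def IsLineSystem (𝓛 : Set (Set E3)) : Prop :=
  (∀ L ∈ 𝓛, IsLine L) ∧ ∀ u : E3, ‖u‖ = 1 → ∃! L, L ∈ 𝓛 ∧ LineParallel L u

/-- A continuous system of lines: the map `δ` sending each direction `u ∈ S²` to the point
of `L_u` closest to the origin is continuous. -/
def IsContinuousLineSystem (𝓛 : Set (Set E3)) : Prop :=
  IsLineSystem 𝓛 ∧ ∃ δ : E3 → E3, ContinuousOn δ (Metric.sphere (0 : E3) 1) ∧
    ∀ u : E3, ‖u‖ = 1 → ∀ L ∈ 𝓛, LineParallel L u →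
      δ u ∈ L ∧ ∀ x ∈ L, ‖δ u‖ ≤ ‖x‖

/-- The center of a system of lines: points lying on at least two distinct lines. -/
def lineSystemCenter (𝓛 : Set (Set E3)) : Set E3 :=
  {x : E3 | ∃ L₁ ∈ 𝓛, ∃ L₂ ∈ 𝓛, L₁ ≠ L₂ ∧ x ∈ L₁ ∧ x ∈ L₂}

/-- A smooth convex body: each boundary point has a unique (unit outer normal of a)
support plane. -/
def IsSmoothBody (K : Set E3) : Prop :=
  ∀ p ∈ frontier K, ∃! n : E3, ‖n‖ = 1 ∧ ∀ x ∈ K, ⟪n, x⟫ ≤ ⟪n, p⟫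

/-- A strictly convex body: the boundary contains no line segment. -/
def IsStrictlyConvexBody (K : Set E3) : Prop :=
  ∀ x ∈ frontier K, ∀ y ∈ frontier K, x ≠ y → ¬ segment ℝ x y ⊆ frontier K

/-- `η` is an outer unit normal field of `K` on its boundary. -/
def IsOuterNormal (K : Set E3) (η : E3 → E3) : Prop :=
  ∀ p ∈ frontier K, ‖η p‖ = 1 ∧ ∀ x ∈ K, ⟪η p, x⟫ ≤ ⟪η p, p⟫

/-- The boundary of `K` is a `C^k` surface: locally, after a rigid motion, it is the graph
of a `C^k` function of two variables. -/
def HasContDiffBoundary (K : Set E3) (k : ℕ) : Prop :=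
  ∀ p ∈ frontier K, ∃ (e : E3 ≃ᵃⁱ[ℝ] E3) (g : ℝ × ℝ → ℝ) (U : Set E3),
    IsOpen U ∧ p ∈ U ∧ ContDiff ℝ k g ∧
    frontier K ∩ U = {x ∈ U | e x 2 = g (e x 0, e x 1)}

end

section

open Filter Topology Set

/-- A smooth strictly convex body together with its outer unit normal field. -/
structure NormalBody (K : Set E3) (η : E3 → E3) : Prop where
  compact : IsCompact K
  convex : Convex ℝ K
  int : (interior K).Nonempty
  smooth : IsSmoothBody K
  strict : IsStrictlyConvexBody K
  normal : IsOuterNormal K η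

/-- The plane `{y | ⟪n, y⟫ = c}` encoded by the pair `(n, c)`. -/
def pl (z : E3 × ℝ) : Set E3 := {y | ⟪z.1, y⟫ = z.2}

theorem mem_pl {z : E3 × ℝ} {y : E3} : y ∈ pl z ↔ ⟪z.1, y⟫ = z.2 := Iff.rfl

theorem convex_pl (z : E3 × ℝ) : Convex ℝ (pl z) := by
  intro x hx y hy a b _ _ hab
  simp only [mem_pl] at *
  rw [inner_add_right, inner_smul_right, inner_smul_right, hx, hy, ← add_mul, hab, one_mul]

theorem exists_frontier_of_preconnected {K S : Set E3} (hS : IsPreconnected S)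
    (h1 : (S ∩ interior K).Nonempty) (h2 : (S ∩ Kᶜ).Nonempty) (hK : IsClosed K) :
    (S ∩ frontier K).Nonempty := by
  by_contra hne
  rw [not_nonempty_iff_eq_empty] at hne
  have hcov : S ⊆ interior K ∪ Kᶜ := by
    intro y hy
    by_cases hyK : y ∈ K
    · left
      by_contra hyi
      have : y ∈ S ∩ frontier K := ⟨hy, by rw [hK.frontier_eq]; exact ⟨hyK, hyi⟩⟩
      simp [hne] at this
    · right; exact hyK
  obtain ⟨y, _, hy1, hy2⟩ := hS _ _ isOpen_interior hK.isOpen_compl hcov h1 h2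
  exact hy2 (interior_subset hy1)

namespace NormalBody

variable {K : Set E3} {η : E3 → E3}

theorem closed (hB : NormalBody K η) : IsClosed K := hB.compact.isClosed

theorem mem_of_frontier (hB : NormalBody K η) {p : E3} (hp : p ∈ frontier K) : p ∈ K :=
  hB.closed.frontier_subset hp

theorem mem_frontier (hB : NormalBody K η) {p : E3} (hp : p ∈ K) (h : p ∉ interior K) :
    p ∈ frontier K := by
  rw [hB.closed.frontier_eq]; exact ⟨hp, h⟩

theorem norm_normal (hB : NormalBody K η) {p : E3} (hp : p ∈ frontier K) : ‖η p‖ = 1 :=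
  (hB.normal p hp).1

theorem normal_le (hB : NormalBody K η) {p x : E3} (hp : p ∈ frontier K) (hx : x ∈ K) :
    ⟪η p, x⟫ ≤ ⟪η p, p⟫ := (hB.normal p hp).2 x hx

theorem normal_unique (hB : NormalBody K η) {p n : E3} (hp : p ∈ frontier K) (hn : ‖n‖ = 1)
    (h : ∀ x ∈ K, ⟪n, x⟫ ≤ ⟪n, p⟫) : n = η p :=
  (hB.smooth p hp).unique ⟨hn, h⟩ (hB.normal p hp)

theorem normal_lt (hB : NormalBody K η) {p x : E3} (hp : p ∈ frontier K) (hx : x ∈ interior K) :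
    ⟪η p, x⟫ < ⟪η p, p⟫ := by
  have hcont : Tendsto (fun t : ℝ => x + t • η p) (𝓝[>] 0) (𝓝 x) := by
    have : Continuous (fun t : ℝ => x + t • η p) := by fun_prop
    have h := this.tendsto 0
    simp only [zero_smul, add_zero] at h
    exact h.mono_left nhdsWithin_le_nhds
  have h1 := hcont.eventually (isOpen_interior.mem_nhds hx)
  obtain ⟨t, ht, ht0⟩ := (h1.and self_mem_nhdsWithin).exists
  have := hB.normal_le hp (interior_subset ht)
  rw [inner_add_right, inner_smul_right, real_inner_self_eq_norm_sq, hB.norm_normal hp] at this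
  have ht0' : (0 : ℝ) < t := ht0
  nlinarith

theorem outside (hB : NormalBody K η) {p u : E3} (hp : p ∈ frontier K) (hu : 0 < ⟪η p, u⟫)
    {t : ℝ} (ht : 0 < t) : p + t • u ∉ K := by
  intro h
  have := hB.normal_le hp h
  rw [inner_add_right, inner_smul_right] at this
  nlinarith [mul_pos ht hu]

theorem add_smul_mem_interior_of_le (hB : NormalBody K η) {p u : E3} (hp : p ∈ K) {t : ℝ}
    (h : p + t • u ∈ interior K) {s : ℝ} (hs : 0 < s) (hst : s ≤ t) :
    p + s • u ∈ interior K := by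
  have ht : 0 < t := hs.trans_le hst
  have := hB.convex.add_smul_mem_interior hp h (t := s / t)
    ⟨by positivity, by rw [div_le_one ht]; exact hst⟩
  rwa [smul_smul, div_mul_cancel₀ _ ht.ne'] at this

/-- From a boundary point, every direction strictly inside the supporting half-space enters the
interior. -/
theorem inward (hB : NormalBody K η) {p u : E3} (hp : p ∈ frontier K) (hu : ⟪η p, u⟫ < 0) :
    ∃ t : ℝ, 0 < t ∧ ∀ s, 0 < s → s ≤ t → p + s • u ∈ interior K := by
  suffices h : ∃ t : ℝ, 0 < t ∧ p + t • u ∈ interior K by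
    obtain ⟨t, ht, h⟩ := h
    exact ⟨t, ht, fun s hs hst =>
      hB.add_smul_mem_interior_of_le (hB.mem_of_frontier hp) h hs hst⟩
  by_contra hno
  push Not at hno
  have hconv : Convex ℝ ((fun t : ℝ => p + t • u) '' Ici 0) := by
    rintro _ ⟨s, hs, rfl⟩ _ ⟨t, ht, rfl⟩ a b ha hb hab
    refine ⟨a * s + b * t, by simp only [mem_Ici] at *; positivity, ?_⟩
    simp only [smul_add, smul_smul, add_smul]
    nth_rewrite 1 [← one_smul ℝ p]
    rw [← hab, add_smul]
    abel
  have hdisj : Disjoint (interior K) ((fun t : ℝ => p + t • u) '' Ici 0) := by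
    rw [Set.disjoint_left]
    rintro _ hx ⟨t, ht, rfl⟩
    rcases (mem_Ici.1 ht).eq_or_lt with h | h
    · subst h
      simp only [zero_smul, add_zero] at hx
      exact hp.2 hx
    · exact hno t h hx
  obtain ⟨g, c, hg1, hg2⟩ := geometric_hahn_banach_open hB.convex.interior isOpen_interior hconv hdisj
  set v := (InnerProductSpace.toDual ℝ E3).symm g with hv
  have hgv : ∀ x, g x = ⟪v, x⟫ := fun x => by
    rw [hv, InnerProductSpace.toDual_symm_apply]
  have hray : ∀ t : ℝ, 0 ≤ t → c ≤ ⟪v, p⟫ + t * ⟪v, u⟫ := fun t ht => by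
    have := hg2 _ ⟨t, ht, rfl⟩
    rwa [hgv, inner_add_right, inner_smul_right] at this
  have hKle : ∀ x ∈ K, ⟪v, x⟫ ≤ c := by
    intro x hx
    have : x ∈ closure (interior K) := by
      rw [hB.convex.closure_interior_eq_closure_of_nonempty_interior hB.int]
      exact subset_closure hx
    refine closure_minimal (s := interior K) (t := {x | ⟪v, x⟫ ≤ c}) ?_ ?_ this
    · intro y hy
      have := hg1 y hy
      rw [hgv] at this
      exact this.le
    · exact isClosed_le (by fun_prop) continuous_const
  have hpc : ⟪v, p⟫ = c := le_antisymm (hKle p (hB.mem_of_frontier hp)) (by simpa using hray 0 le_rfl)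
  have hv0 : v ≠ 0 := by
    intro h0
    obtain ⟨x, hx⟩ := hB.int
    have := hg1 x hx
    rw [hgv, ← hpc] at this
    simp [h0] at this
  have hvu : 0 ≤ ⟪v, u⟫ := by
    have := hray 1 zero_le_one
    linarith
  have hnv : 0 < ‖v‖ := norm_pos_iff.2 hv0
  have := hB.normal_unique (n := ‖v‖⁻¹ • v) hp
    (by rw [norm_smul, norm_inv, norm_norm, inv_mul_cancel₀ hnv.ne']) (by
      intro x hx
      rw [real_inner_smul_left, real_inner_smul_left, hpc]
      have := hKle x hx
      gcongr)
  rw [← this, real_inner_smul_left] at hu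
  have : 0 ≤ ‖v‖⁻¹ * ⟪v, u⟫ := by positivity
  linarith

/-- A ray from an interior point meets the boundary. -/
theorem exits (hB : NormalBody K η) {w e : E3} (hw : w ∈ interior K) (he : e ≠ 0) :
    ∃ t : ℝ, 0 < t ∧ w + t • e ∈ frontier K := by
  obtain ⟨R, hR⟩ := hB.compact.isBounded.subset_closedBall w
  have hne : 0 < ‖e‖ := norm_pos_iff.2 he
  set T : ℝ := (|R| + 1) / ‖e‖ with hT
  have hTpos : 0 < T := by positivity
  have hout : w + T • e ∉ K := by
    intro h
    have := hR h
    rw [Metric.mem_closedBall, dist_eq_norm, add_sub_cancel_left, norm_smul, Real.norm_eq_abs,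
      abs_of_pos hTpos, hT, div_mul_cancel₀ _ hne.ne'] at this
    linarith [le_abs_self R]
  have hpre : IsPreconnected ((fun t : ℝ => w + t • e) '' Icc 0 T) :=
    isPreconnected_Icc.image _ (by fun_prop)
  obtain ⟨_, ⟨t, ht, rfl⟩, hf⟩ := exists_frontier_of_preconnected (K := K) hpre
    ⟨w, ⟨0, ⟨le_rfl, hTpos.le⟩, by simp⟩, hw⟩ ⟨_, ⟨T, ⟨hTpos.le, le_rfl⟩, rfl⟩, hout⟩ hB.closed
  refine ⟨t, ?_, hf⟩
  rcases ht.1.eq_or_lt with h | h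
  · subst h
    simp only [zero_smul, add_zero] at hf
    exact absurd hw hf.2
  · exact h

/-- Open chords of a strictly convex body lie in the interior: some point does. -/
theorem exists_chord_interior (hB : NormalBody K η) {x y : E3} (hx : x ∈ frontier K)
    (hy : y ∈ frontier K) (hxy : x ≠ y) : ∃ z ∈ segment ℝ x y, z ∈ interior K := by
  have := hB.strict x hx y hy hxy
  rw [not_subset] at this
  obtain ⟨z, hz, hzf⟩ := this
  refine ⟨z, hz, ?_⟩
  by_contra h
  exact hzf (hB.mem_frontier (hB.convex.segment_subset (hB.mem_of_frontier hx)
    (hB.mem_of_frontier hy) hz) h)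

/-- Two distinct boundary points common to two planes force the planes to meet in the interior. -/
theorem meet_of_two (hB : NormalBody K η) {z w : E3 × ℝ} {x y : E3} (hx : x ∈ frontier K)
    (hy : y ∈ frontier K) (hxy : x ≠ y) (hxz : x ∈ pl z) (hyz : y ∈ pl z) (hxw : x ∈ pl w)
    (hyw : y ∈ pl w) : (pl z ∩ pl w ∩ interior K).Nonempty := by
  obtain ⟨t, ht, hti⟩ := hB.exists_chord_interior hx hy hxy
  exact ⟨t, ⟨(convex_pl z).segment_subset hxz hyz ht, (convex_pl w).segment_subset hxw hyw ht⟩, hti⟩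

/-- Past the boundary along a ray from an interior point one is outside. -/
theorem interior_of_between (hB : NormalBody K η) {w e : E3} (hw : w ∈ interior K) {t : ℝ}
    (ht : w + t • e ∈ K) {s : ℝ} (hs : 0 ≤ s) (hst : s < t) : w + s • e ∈ interior K := by
  have ht0 : 0 < t := hs.trans_lt hst
  have := hB.convex.combo_interior_self_mem_interior hw ht (a := 1 - s / t) (b := s / t)
    (by rw [sub_pos, div_lt_one ht0]; exact hst) (by positivity) (by ring)
  convert this using 1
  rw [smul_add, smul_smul, div_mul_cancel₀ _ ht0.ne', sub_smul, one_smul]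
  abel

theorem normal_continuousOn (hB : NormalBody K η) : ContinuousOn η (frontier K) := by
  intro p hp
  rw [ContinuousWithinAt, tendsto_iff_ultrafilter]
  intro U hU
  have hUf : ∀ᶠ x in (U : Filter E3), x ∈ frontier K := hU self_mem_nhdsWithin
  have hUp : Tendsto id (U : Filter E3) (𝓝 p) := hU.trans nhdsWithin_le_nhds
  have hmap : (U.map η : Filter E3) ≤ 𝓟 (Metric.sphere (0 : E3) 1) := by
    rw [le_principal_iff]
    show ∀ᶠ x in (U : Filter E3), η x ∈ Metric.sphere (0 : E3) 1
    filter_upwards [hUf] with x hx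
    simpa using hB.norm_normal hx
  obtain ⟨n, hn, hlim⟩ := (isCompact_sphere (0 : E3) 1).ultrafilter_le_nhds _ hmap
  have hlim' : Tendsto η (U : Filter E3) (𝓝 n) := hlim
  have : n = η p := by
    refine hB.normal_unique hp (by simpa using hn) fun x hx => ?_
    have h1 : Tendsto (fun y => ⟪η y, x⟫) (U : Filter E3) (𝓝 ⟪n, x⟫) :=
      hlim'.inner tendsto_const_nhds
    have h2 : Tendsto (fun y => ⟪η y, id y⟫) (U : Filter E3) (𝓝 ⟪n, p⟫) := hlim'.inner hUp
    exact le_of_tendsto_of_tendsto h1 h2 (hUf.mono fun y hy => hB.normal_le hy hx)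
  rw [← this]
  exact hlim'

end NormalBody

/-- Three vectors with no common nonzero orthogonal vector. -/
def Trip (a b c : E3) : Prop := ∀ x : E3, ⟪a, x⟫ = 0 → ⟪b, x⟫ = 0 → ⟪c, x⟫ = 0 → x = 0

theorem exists_orthogonal_pair (a b : E3) : ∃ e : E3, e ≠ 0 ∧ ⟪a, e⟫ = 0 ∧ ⟪b, e⟫ = 0 := by
  let f : E3 →ₗ[ℝ] ℝ × ℝ := (innerₛₗ ℝ a).prod (innerₛₗ ℝ b)
  have hker : LinearMap.ker f ≠ ⊥ := by
    intro h
    have := LinearMap.finrank_le_finrank_of_injective (LinearMap.ker_eq_bot.1 h)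
    simp at this
  obtain ⟨e, he, hne⟩ := (Submodule.ne_bot_iff _).1 hker
  have h1 : f e = 0 := he
  have h2 : (⟪a, e⟫, ⟪b, e⟫) = ((0 : ℝ), (0 : ℝ)) := h1
  exact ⟨e, hne, congrArg Prod.fst h2, congrArg Prod.snd h2⟩

theorem abs_inner_lt_one {a b : E3} (ha : ‖a‖ = 1) (hb : ‖b‖ = 1) (h1 : a ≠ b) (h2 : a ≠ -b) :
    |⟪a, b⟫| < 1 := by
  rw [abs_lt]
  have e1 := norm_sub_sq_real a b
  have e2 := norm_add_sq_real a b
  have p1 : 0 < ‖a - b‖ := norm_pos_iff.2 (sub_ne_zero.2 h1)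
  have p2 : 0 < ‖a + b‖ := norm_pos_iff.2 (fun h => h2 (eq_neg_of_add_eq_zero_left h))
  rw [ha, hb] at e1 e2
  constructor <;> nlinarith [sq_pos_of_pos p1, sq_pos_of_pos p2]

theorem trip_of_ne {a b c d : E3} (ha : ‖a‖ = 1) (hb : ‖b‖ = 1) (h1 : a ≠ b) (h2 : a ≠ -b)
    (hda : ⟪a, d⟫ = 0) (hdb : ⟪b, d⟫ = 0) (hdc : ⟪c, d⟫ ≠ 0) : Trip a b c := by
  have hli : LinearIndependent ℝ ![a, b, c] := by
    rw [Fintype.linearIndependent_iff]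
    intro g hg
    simp only [Fin.sum_univ_three, Matrix.cons_val_zero, Matrix.cons_val_one, Matrix.cons_val] at hg
    have hd := congrArg (fun x => ⟪x, d⟫) hg
    simp only [inner_add_left, real_inner_smul_left, hda, hdb, inner_zero_left] at hd
    have h3 : g 2 = 0 := by
      have : g 2 * ⟪c, d⟫ = 0 := by linarith
      exact (mul_eq_zero.1 this).resolve_right hdc
    rw [h3, zero_smul, add_zero] at hg
    have i1 := congrArg (fun x => ⟪x, a⟫) hg
    have i2 := congrArg (fun x => ⟪x, b⟫) hg
    simp only [inner_add_left, real_inner_smul_left, inner_zero_left,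
      real_inner_self_eq_norm_sq, ha, hb] at i1 i2
    rw [real_inner_comm] at i1
    have hlt := abs_inner_lt_one ha hb h1 h2
    rw [abs_lt] at hlt
    have hpos : 0 < 1 - ⟪a, b⟫ ^ 2 := by nlinarith
    have h0 : g 0 = 0 := by
      have : g 0 * (1 - ⟪a, b⟫ ^ 2) = 0 := by linear_combination i1 - ⟪a, b⟫ * i2
      exact (mul_eq_zero.1 this).resolve_right hpos.ne'
    have h1' : g 1 = 0 := by
      rw [h0] at i2
      linarith
    intro i
    fin_cases i <;> assumption
  have hspan := hli.span_eq_top_of_card_eq_finrank (by simp)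
  intro x hxa hxb hxc
  have : x ∈ Submodule.span ℝ (Set.range ![a, b, c]) := by rw [hspan]; trivial
  have hall : ∀ y ∈ Submodule.span ℝ (Set.range ![a, b, c]), ⟪y, x⟫ = 0 := by
    intro y hy
    induction hy using Submodule.span_induction with
    | mem y hy =>
      obtain ⟨i, rfl⟩ := hy
      fin_cases i <;> assumption
    | zero => simp
    | add y z _ _ h1 h2 => rw [inner_add_left, h1, h2, add_zero]
    | smul t y _ h => rw [real_inner_smul_left, h, mul_zero]
  exact inner_self_eq_zero.1 (hall x this)

theorem Trip.exists_dual {a b c : E3} (h : Trip a b c) :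
    ∃ v : E3, ⟪a, v⟫ = 1 ∧ ⟪b, v⟫ = 0 ∧ ⟪c, v⟫ = 0 := by
  obtain ⟨e, he, hb, hc⟩ := exists_orthogonal_pair b c
  have ha : ⟪a, e⟫ ≠ 0 := fun ha => he (h e ha hb hc)
  exact ⟨⟪a, e⟫⁻¹ • e, by rw [inner_smul_right, inv_mul_cancel₀ ha],
    by rw [inner_smul_right, hb, mul_zero], by rw [inner_smul_right, hc, mul_zero]⟩

theorem Trip.rotate {a b c : E3} (h : Trip a b c) : Trip b c a := fun x h1 h2 h3 => h x h3 h1 h2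

theorem trip_of_normal {a b e : E3} (ha : ‖a‖ = 1) (hb : ‖b‖ = 1) (h1 : a ≠ b) (h2 : a ≠ -b)
    (he : ‖e‖ = 1) (hda : ⟪a, e⟫ = 0) (hdb : ⟪b, e⟫ = 0) : Trip a b e :=
  trip_of_ne ha hb h1 h2 hda hdb (by rw [real_inner_self_eq_norm_sq, he]; norm_num)

theorem eq_smul_of_orthogonal {a b e : E3} (ha : ‖a‖ = 1) (hb : ‖b‖ = 1) (h1 : a ≠ b)
    (h2 : a ≠ -b) (he : ‖e‖ = 1) (hda : ⟪a, e⟫ = 0) (hdb : ⟪b, e⟫ = 0) {x : E3}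
    (hxa : ⟪a, x⟫ = 0) (hxb : ⟪b, x⟫ = 0) : x = ⟪e, x⟫ • e := by
  rw [← sub_eq_zero]
  refine trip_of_normal ha hb h1 h2 he hda hdb _ ?_ ?_ ?_ <;>
    rw [inner_sub_right, inner_smul_right]
  · rw [hxa, hda]; ring
  · rw [hxb, hdb]; ring
  · rw [real_inner_self_eq_norm_sq, he]; ring

/-- A quadratic polynomial on `E3`. -/
structure QF where
  /-- the bilinear part -/
  B : E3 →L[ℝ] E3 →L[ℝ] ℝ
  /-- the linear part -/
  l : E3 →L[ℝ] ℝ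
  /-- the constant part -/
  c : ℝ

namespace QF

/-- Evaluation of a quadratic polynomial. -/
noncomputable def ev (F : QF) (x : E3) : ℝ := F.B x x + F.l x + F.c

/-- The differential of a quadratic polynomial at `b`. -/
noncomputable def D (F : QF) (b : E3) : E3 →L[ℝ] ℝ := F.B b + F.B.flip b + F.l

theorem D_apply (F : QF) (b v : E3) : F.D b v = F.B b v + F.B v b + F.l v := rfl

theorem ev_add_smul (F : QF) (b v : E3) (t : ℝ) :
    F.ev (b + t • v) = F.ev b + t * F.D b v + t ^ 2 * F.B v v := by
  simp only [ev, D_apply, map_add, map_smul, add_apply,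
    smul_apply, smul_eq_mul]
  ring

theorem continuous_ev (F : QF) : Continuous F.ev := by
  unfold ev
  fun_prop

end QF

/-- `F` vanishes on the section of the boundary of `K` by the plane `z`. -/
def QP (K : Set E3) (F : QF) (z : E3 × ℝ) : Prop := ∀ y ∈ frontier K, y ∈ pl z → F.ev y = 0

namespace NormalBody

variable {K : Set E3} {η : E3 → E3}

/-- A quadratic vanishing on a section transversal to the boundary has zero derivative along the
tangent line of that section. -/
theorem D_eq_zero_of_QP (hB : NormalBody K η) {F : QF} {z : E3 × ℝ} (hF : QP K F z) {b w : E3}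
    (hb : b ∈ frontier K) (hbz : b ∈ pl z) (hw : w ∈ interior K) (hwz : w ∈ pl z) {v : E3}
    (hv : ⟪z.1, v⟫ = 0) (hvη : ⟪η b, v⟫ = 0) : F.D b v = 0 := by
  by_contra hne
  set d := w - b with hd
  have hdz : ⟪z.1, d⟫ = 0 := by
    rw [mem_pl] at hbz hwz
    rw [hd, inner_sub_right, hbz, hwz, sub_self]
  have hdη : ⟪η b, d⟫ < 0 := by
    rw [hd, inner_sub_right]
    linarith [hB.normal_lt hb hw]
  let g : ℝ × ℝ → ℝ := fun q => F.D b (v + q.1 • d) + q.2 * F.B (v + q.1 • d) (v + q.1 • d)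
  have hg : Continuous g := by
    simp only [g]
    fun_prop
  have hg0 : g (0, 0) ≠ 0 := by simpa [g] using hne
  have hev : ∀ᶠ q in 𝓝 ((0 : ℝ), (0 : ℝ)), g q ≠ 0 := hg.continuousAt.eventually_ne hg0
  obtain ⟨ε, hε, hball⟩ := Metric.eventually_nhds_iff.1 hev
  have hδ : 0 < ε / 2 := by linarith
  set δ := ε / 2 with hδdef
  have hin : ⟪η b, v + δ • d⟫ < 0 := by
    rw [inner_add_right, inner_smul_right, hvη]
    nlinarith
  have hout : 0 < ⟪η b, v + (-δ) • d⟫ := by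
    rw [inner_add_right, inner_smul_right, hvη]
    nlinarith
  obtain ⟨t₀, ht₀, ht⟩ := hB.inward hb hin
  set t := min t₀ δ with htdef
  have htpos : 0 < t := lt_min ht₀ hδ
  have hpre : IsPreconnected ((fun s : ℝ => b + t • (v + s • d)) '' Icc (-δ) δ) :=
    isPreconnected_Icc.image _ (by fun_prop)
  obtain ⟨_, ⟨s, hs, rfl⟩, hf⟩ := exists_frontier_of_preconnected (K := K) hpre
    ⟨_, ⟨δ, ⟨by linarith, le_rfl⟩, rfl⟩, ht t htpos (min_le_left _ _)⟩
    ⟨_, ⟨-δ, ⟨le_rfl, by linarith⟩, rfl⟩, hB.outside hb hout htpos⟩ hB.closed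
  have hz : b + t • (v + s • d) ∈ pl z := by
    rw [mem_pl] at hbz ⊢
    simp [inner_add_right, inner_smul_right, hv, hdz, hbz]
  have h1 := hF _ hf hz
  rw [F.ev_add_smul, hF b hb hbz] at h1
  have h2 : g (s, t) = 0 := by
    have : t * g (s, t) = 0 := by simp only [g]; linear_combination h1
    exact (mul_eq_zero.1 this).resolve_left htpos.ne'
  refine hball ?_ h2
  rw [Prod.dist_eq, max_lt_iff]
  simp only [Real.dist_eq, sub_zero]
  constructor
  · have := abs_le.2 hs
    linarith
  · rw [abs_of_pos htpos]
    have := min_le_right t₀ δ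
    linarith

/-- Two sections crossing transversally force the whole tangent plane into the kernel of the
differential. -/
theorem D_eq_zero_of_two (hB : NormalBody K η) {F : QF} {z z' : E3 × ℝ} (hF : QP K F z)
    (hF' : QP K F z') (hn : ‖z.1‖ = 1) (hn' : ‖z'.1‖ = 1) (hne : pl z ≠ pl z')
    (hmeet : (pl z ∩ pl z' ∩ interior K).Nonempty) {b : E3}
    (hb : b ∈ frontier K) (hbz : b ∈ pl z) (hbz' : b ∈ pl z') {v : E3} (hv : ⟪η b, v⟫ = 0) :
    F.D b v = 0 := by
  obtain ⟨w, ⟨hw1, hw2⟩, hwi⟩ := hmeet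
  have h1 : z.1 ≠ z'.1 := by
    intro h
    apply hne
    have : z.2 = z'.2 := by rw [← mem_pl.1 hbz, ← mem_pl.1 hbz', h]
    rw [Prod.ext h this]
  have h2 : z.1 ≠ -z'.1 := by
    intro h
    apply hne
    have h3 : z.2 = -z'.2 := by rw [← mem_pl.1 hbz, ← mem_pl.1 hbz', h, inner_neg_left]
    ext y
    rw [mem_pl, mem_pl, h, h3, inner_neg_left, neg_inj]
  have hd : ⟪η b, w - b⟫ ≠ 0 := by
    rw [inner_sub_right]
    linarith [hB.normal_lt hb hwi]
  have hT : Trip z.1 z'.1 (η b) := trip_of_ne hn hn' h1 h2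
    (by rw [inner_sub_right, mem_pl.1 hw1, mem_pl.1 hbz, sub_self])
    (by rw [inner_sub_right, mem_pl.1 hw2, mem_pl.1 hbz', sub_self]) hd
  obtain ⟨u, hu1, hu2, hu3⟩ := hT.exists_dual
  obtain ⟨u', hu'1, hu'3, hu'2⟩ := hT.rotate.exists_dual
  have hdec : v = ⟪z.1, v⟫ • u + ⟪z'.1, v⟫ • u' := by
    rw [← sub_eq_zero]
    apply hT <;> simp [inner_sub_right, inner_add_right, inner_smul_right, *]
  rw [hdec, map_add, map_smul, map_smul, hB.D_eq_zero_of_QP hF hb hbz hwi hw1 hu'2 hu'3,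
    hB.D_eq_zero_of_QP hF' hb hbz' hwi hw2 hu2 hu3]
  simp

end NormalBody

theorem IsEllipse.exists_param {E : Set E3} (hE : IsEllipse E) :
    ∃ o u v : E3, (∀ s t : ℝ, s • u + t • v = 0 → s = 0 ∧ t = 0) ∧
      ∀ y, y ∈ E ↔ ∃ s t : ℝ, s ^ 2 + t ^ 2 = 1 ∧ y = o + s • u + t • v := by
  obtain ⟨φ, rfl⟩ := hE
  have hφ : ∀ x : E3, φ x = φ 0 + φ.linear x := fun x => by
    have := φ.map_vadd 0 x
    simpa [add_comm] using this
  have hdec : ∀ s t : ℝ, (!₂[s, t, 0] : E3) = s • !₂[1, 0, 0] + t • !₂[0, 1, 0] := by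
    intro s t
    ext i
    fin_cases i <;> simp
  refine ⟨φ 0, φ.linear !₂[1, 0, 0], φ.linear !₂[0, 1, 0], ?_, ?_⟩
  · intro s t h
    rw [← map_smul, ← map_smul, ← map_add, ← hdec, LinearEquiv.map_eq_zero_iff] at h
    exact ⟨by simpa using congrArg (fun x : E3 => x 0) h, by simpa using congrArg (fun x : E3 => x 1) h⟩
  · intro y
    constructor
    · rintro ⟨x, ⟨hx1, hx2⟩, rfl⟩
      refine ⟨x 0, x 1, hx1, ?_⟩
      rw [hφ x, add_assoc, ← map_smul, ← map_smul, ← map_add, ← hdec]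
      congr 2
      ext i
      fin_cases i <;> simp [hx2]
    · rintro ⟨s, t, hst, rfl⟩
      refine ⟨!₂[s, t, 0], ⟨by simpa using hst, by simp⟩, ?_⟩
      rw [hφ, hdec, map_add, map_smul, map_smul, add_assoc]

theorem cubic_coeff_eq_zero {a b c d z₁ z₂ z₃ z₄ : ℂ} (h12 : z₁ ≠ z₂) (h13 : z₁ ≠ z₃)
    (h14 : z₁ ≠ z₄) (h23 : z₂ ≠ z₃) (h24 : z₂ ≠ z₄) (h34 : z₃ ≠ z₄)
    (h : ∀ z, z = z₁ ∨ z = z₂ ∨ z = z₃ ∨ z = z₄ → a * z ^ 3 + b * z ^ 2 + c * z + d = 0) :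
    a = 0 ∧ b = 0 ∧ c = 0 ∧ d = 0 := by
  have key : (Polynomial.C a * Polynomial.X ^ 3 + Polynomial.C b * Polynomial.X ^ 2 +
      Polynomial.C c * Polynomial.X + Polynomial.C d : Polynomial ℂ) = 0 := by
    refine Polynomial.eq_zero_of_degree_lt_of_eval_finset_eq_zero ({z₁, z₂, z₃, z₄} : Finset ℂ) ?_ ?_
    · refine Polynomial.degree_cubic_le.trans_lt ?_
      rw [Finset.card_insert_of_notMem (by simp [h12, h13, h14]),
        Finset.card_insert_of_notMem (by simp [h23, h24]),
        Finset.card_insert_of_notMem (by simp [h34]), Finset.card_singleton]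
      norm_num
    · intro z hz
      simp only [Finset.mem_insert, Finset.mem_singleton] at hz
      simpa using h z hz
  refine ⟨?_, ?_, ?_, ?_⟩
  · simpa [Polynomial.coeff_X, Polynomial.coeff_C] using congrArg (fun p => Polynomial.coeff p 3) key
  · simpa [Polynomial.coeff_X, Polynomial.coeff_C] using congrArg (fun p => Polynomial.coeff p 2) key
  · simpa [Polynomial.coeff_X, Polynomial.coeff_C] using congrArg (fun p => Polynomial.coeff p 1) key
  · simpa [Polynomial.coeff_X, Polynomial.coeff_C] using congrArg (fun p => Polynomial.coeff p 0) key

/-- A quartic vanishing at four distinct points, and either at a fifth point or to second order at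
the first one, is zero. -/
theorem quartic_eq_zero {a b c d e z₁ z₂ z₃ z₄ : ℂ} (h12 : z₁ ≠ z₂) (h13 : z₁ ≠ z₃)
    (h14 : z₁ ≠ z₄) (h23 : z₂ ≠ z₃) (h24 : z₂ ≠ z₄) (h34 : z₃ ≠ z₄)
    (h : ∀ z, z = z₁ ∨ z = z₂ ∨ z = z₃ ∨ z = z₄ →
      a * z ^ 4 + b * z ^ 3 + c * z ^ 2 + d * z + e = 0)
    (h5 : (∃ z, z ≠ z₁ ∧ z ≠ z₂ ∧ z ≠ z₃ ∧ z ≠ z₄ ∧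
        a * z ^ 4 + b * z ^ 3 + c * z ^ 2 + d * z + e = 0) ∨
      4 * a * z₁ ^ 3 + 3 * b * z₁ ^ 2 + 2 * c * z₁ + d = 0) :
    a = 0 ∧ b = 0 ∧ c = 0 ∧ d = 0 ∧ e = 0 := by
  obtain ⟨hb, hc, hd, he⟩ := cubic_coeff_eq_zero (a := b + a * (z₁ + z₂ + z₃ + z₄))
    (b := c - a * (z₁ * z₂ + z₁ * z₃ + z₁ * z₄ + z₂ * z₃ + z₂ * z₄ + z₃ * z₄))
    (c := d + a * (z₁ * z₂ * z₃ + z₁ * z₂ * z₄ + z₁ * z₃ * z₄ + z₂ * z₃ * z₄))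
    (d := e - a * (z₁ * z₂ * z₃ * z₄)) h12 h13 h14 h23 h24 h34 (by
      intro z hz
      have h0 := h z hz
      have h1 : (z - z₁) * (z - z₂) * (z - z₃) * (z - z₄) = 0 := by
        rcases hz with rfl | rfl | rfl | rfl <;> ring
      linear_combination h0 - a * h1)
  have ha : a = 0 := by
    rcases h5 with ⟨z, hz1, hz2, hz3, hz4, hz⟩ | h5
    · have : a * ((z - z₁) * (z - z₂) * (z - z₃) * (z - z₄)) = 0 := by
        linear_combination hz - z ^ 3 * hb - z ^ 2 * hc - z * hd - he
      refine (mul_eq_zero.1 this).resolve_right ?_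
      simp [sub_eq_zero, hz1, hz2, hz3, hz4]
    · have : a * ((z₁ - z₂) * (z₁ - z₃) * (z₁ - z₄)) = 0 := by
        linear_combination h5 - 3 * z₁ ^ 2 * hb - 2 * z₁ * hc - hd
      refine (mul_eq_zero.1 this).resolve_right ?_
      simp [sub_eq_zero, h12, h13, h14]
  subst ha
  refine ⟨rfl, ?_, ?_, ?_, ?_⟩
  · linear_combination hb
  · linear_combination hc
  · linear_combination hd
  · linear_combination he

/-- A quadratic polynomial on the unit circle with five zeros, the first one possibly double,
vanishes on the circle. -/
theorem circle_quadratic_eq_zero {α β γ δ ε ζ : ℝ} {p₁ p₂ p₃ p₄ : ℝ × ℝ}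
    (h12 : p₁ ≠ p₂) (h13 : p₁ ≠ p₃) (h14 : p₁ ≠ p₄) (h23 : p₂ ≠ p₃) (h24 : p₂ ≠ p₄)
    (h34 : p₃ ≠ p₄)
    (h : ∀ p, p = p₁ ∨ p = p₂ ∨ p = p₃ ∨ p = p₄ → p.1 ^ 2 + p.2 ^ 2 = 1 ∧
      α * p.1 ^ 2 + β * p.1 * p.2 + γ * p.2 ^ 2 + δ * p.1 + ε * p.2 + ζ = 0)
    (h5 : (∃ p : ℝ × ℝ, p ≠ p₁ ∧ p ≠ p₂ ∧ p ≠ p₃ ∧ p ≠ p₄ ∧ p.1 ^ 2 + p.2 ^ 2 = 1 ∧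
        α * p.1 ^ 2 + β * p.1 * p.2 + γ * p.2 ^ 2 + δ * p.1 + ε * p.2 + ζ = 0) ∨
      -p₁.2 * (2 * α * p₁.1 + β * p₁.2 + δ) + p₁.1 * (β * p₁.1 + 2 * γ * p₁.2 + ε) = 0)
    {s t : ℝ} (hst : s ^ 2 + t ^ 2 = 1) :
    α * s ^ 2 + β * s * t + γ * t ^ 2 + δ * s + ε * t + ζ = 0 := by
  have hI : Complex.I ^ 2 = -1 := Complex.I_sq
  let Z : ℝ × ℝ → ℂ := fun p => p.1 + p.2 * Complex.I
  have hZ : ∀ {p q : ℝ × ℝ}, p ≠ q → Z p ≠ Z q := by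
    intro p q hpq hZ
    apply hpq
    have h1 := congrArg Complex.re hZ
    have h2 := congrArg Complex.im hZ
    simp [Z] at h1 h2
    exact Prod.ext h1 h2
  set A : ℂ := (α - γ) / 4 - β * Complex.I / 4 with hA
  set B : ℂ := δ / 2 - ε * Complex.I / 2 with hB
  set C : ℂ := (α + γ) / 2 + ζ with hC
  set D : ℂ := δ / 2 + ε * Complex.I / 2 with hD
  set E : ℂ := (α - γ) / 4 + β * Complex.I / 4 with hE
  have hfacts : ∀ p : ℝ × ℝ, p.1 ^ 2 + p.2 ^ 2 = 1 → Z p ≠ 0 ∧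
      Z p ^ 2 * (p.1 : ℂ) = (Z p ^ 3 + Z p) / 2 ∧
      Z p ^ 2 * (p.2 : ℂ) = -Complex.I * (Z p ^ 3 - Z p) / 2 ∧
      Z p ^ 2 * (p.1 : ℂ) ^ 2 = (Z p ^ 4 + 2 * Z p ^ 2 + 1) / 4 ∧
      Z p ^ 2 * ((p.1 : ℂ) * p.2) = -Complex.I * (Z p ^ 4 - 1) / 4 ∧
      Z p ^ 2 * (p.2 : ℂ) ^ 2 = -(Z p ^ 4 - 2 * Z p ^ 2 + 1) / 4 := by
    intro p hp
    have hp' : (p.1 : ℂ) ^ 2 + (p.2 : ℂ) ^ 2 = 1 := by exact_mod_cast hp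
    obtain ⟨w, hw⟩ : ∃ w : ℂ, w = p.1 - p.2 * Complex.I := ⟨_, rfl⟩
    have hzw : Z p * w = 1 := by
      simp only [Z, hw]
      linear_combination hp' - (p.2 : ℂ) ^ 2 * hI
    have hs : (p.1 : ℂ) = (Z p + w) / 2 := by simp only [Z, hw]; ring
    have ht : (p.2 : ℂ) = -Complex.I * (Z p - w) / 2 := by
      simp only [Z, hw]; linear_combination (p.2 : ℂ) * hI
    rw [hs, ht]
    refine ⟨left_ne_zero_of_mul_eq_one hzw, ?_, ?_, ?_, ?_, ?_⟩
    · linear_combination Z p / 2 * hzw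
    · linear_combination Complex.I * Z p / 2 * hzw
    · linear_combination (2 * Z p ^ 2 + Z p * w + 1) / 4 * hzw
    · linear_combination Complex.I * (Z p * w + 1) / 4 * hzw
    · linear_combination (Z p ^ 4 - 2 * Z p ^ 2 * (Z p * w) + (Z p * w) ^ 2) / 4 * hI +
        (2 * Z p ^ 2 - (Z p * w + 1)) / 4 * hzw
  have hid : ∀ p : ℝ × ℝ, p.1 ^ 2 + p.2 ^ 2 = 1 →
      A * Z p ^ 4 + B * Z p ^ 3 + C * Z p ^ 2 + D * Z p + E = Z p ^ 2 *
      ((α * p.1 ^ 2 + β * p.1 * p.2 + γ * p.2 ^ 2 + δ * p.1 + ε * p.2 + ζ : ℝ) : ℂ) := by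
    intro p hp
    obtain ⟨_, f1, f2, f3, f4, f5⟩ := hfacts p hp
    push_cast
    rw [hA, hB, hC, hD, hE]
    linear_combination -(α : ℂ) * f3 - β * f4 - γ * f5 - δ * f1 - ε * f2
  have hroot : ∀ p : ℝ × ℝ, p.1 ^ 2 + p.2 ^ 2 = 1 →
      α * p.1 ^ 2 + β * p.1 * p.2 + γ * p.2 ^ 2 + δ * p.1 + ε * p.2 + ζ = 0 →
      A * Z p ^ 4 + B * Z p ^ 3 + C * Z p ^ 2 + D * Z p + E = 0 := by
    intro p hp h0
    rw [hid p hp, h0]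
    simp
  have hp₁ := h p₁ (Or.inl rfl)
  obtain ⟨a0, b0, c0, d0, e0⟩ := quartic_eq_zero (a := A) (b := B) (c := C) (d := D) (e := E)
    (hZ h12) (hZ h13) (hZ h14) (hZ h23) (hZ h24) (hZ h34)
    (by
      rintro z (rfl | rfl | rfl | rfl)
      · exact hroot _ hp₁.1 hp₁.2
      · exact hroot _ (h p₂ (by simp)).1 (h p₂ (by simp)).2
      · exact hroot _ (h p₃ (by simp)).1 (h p₃ (by simp)).2
      · exact hroot _ (h p₄ (by simp)).1 (h p₄ (by simp)).2)
    (by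
      rcases h5 with ⟨p, g1, g2, g3, g4, gc, g0⟩ | h5
      · exact Or.inl ⟨Z p, hZ g1, hZ g2, hZ g3, hZ g4, hroot p gc g0⟩
      · right
        have hr := hroot p₁ hp₁.1 hp₁.2
        obtain ⟨hz, f1, f2, f3, f4, f5⟩ := hfacts p₁ hp₁.1
        have h5' : -(p₁.2 : ℂ) * (2 * α * p₁.1 + β * p₁.2 + δ) +
            p₁.1 * (β * p₁.1 + 2 * γ * p₁.2 + ε) = 0 := by exact_mod_cast h5
        have : Complex.I * Z p₁ * (4 * A * Z p₁ ^ 3 + 3 * B * Z p₁ ^ 2 + 2 * C * Z p₁ + D) = 0 := by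
          have e1 : Complex.I * (2 * A * Z p₁ ^ 4 + B * Z p₁ ^ 3 - D * Z p₁ - 2 * E) = 0 := by
            rw [hA, hB, hD, hE]
            linear_combination Z p₁ ^ 2 * h5' + 2 * ((α : ℂ) - γ) * f4 - β * f3 + β * f5 + δ * f2
              - ε * f1 - (β / 2 * (Z p₁ ^ 4 + 1) + ε / 2 * (Z p₁ ^ 3 + Z p₁)) * hI
          linear_combination e1 + 2 * Complex.I * hr
        exact (mul_eq_zero.1 this).resolve_left (mul_ne_zero Complex.I_ne_zero hz))
  have hfin := hid (s, t) hst
  rw [a0, b0, c0, d0, e0] at hfin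
  have hz := (hfacts (s, t) hst).1
  have : ((α * s ^ 2 + β * s * t + γ * t ^ 2 + δ * s + ε * t + ζ : ℝ) : ℂ) = 0 := by
    have h0 : Z (s, t) ^ 2 * ((α * s ^ 2 + β * s * t + γ * t ^ 2 + δ * s + ε * t + ζ : ℝ) : ℂ) = 0 := by
      rw [← hfin]; ring
    exact (mul_eq_zero.1 h0).resolve_left (pow_ne_zero _ hz)
  exact_mod_cast this

/-- If a linear functional restricted to the unit circle is maximal at a point, its tangential
derivative there vanishes. -/
theorem tangential_eq_zero {A B s t : ℝ} (hst : s ^ 2 + t ^ 2 = 1)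
    (h : ∀ x y : ℝ, x ^ 2 + y ^ 2 = 1 → A * x + B * y ≤ A * s + B * t) : -t * A + s * B = 0 := by
  by_cases h0 : A ^ 2 + B ^ 2 = 0
  · have hA : A = 0 := by nlinarith [sq_nonneg A, sq_nonneg B]
    have hB : B = 0 := by nlinarith [sq_nonneg A, sq_nonneg B]
    simp [hA, hB]
  · have hpos : 0 < A ^ 2 + B ^ 2 := lt_of_le_of_ne (by positivity) (Ne.symm h0)
    set R := Real.sqrt (A ^ 2 + B ^ 2) with hR
    have hR0 : 0 < R := Real.sqrt_pos.2 hpos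
    have hR2 : R ^ 2 = A ^ 2 + B ^ 2 := Real.sq_sqrt hpos.le
    have h1 := h (A / R) (B / R) (by
      rw [div_pow, div_pow, ← add_div, hR2, div_self h0])
    have h2 : A * (A / R) + B * (B / R) = R := by
      field_simp
      linarith
    rw [h2] at h1
    have h3 : (A * s + B * t) ^ 2 + (-t * A + s * B) ^ 2 = R ^ 2 := by
      rw [hR2]
      linear_combination (A ^ 2 + B ^ 2) * hst
    have : (-t * A + s * B) ^ 2 ≤ 0 := by nlinarith
    exact pow_eq_zero_iff (two_ne_zero) |>.1 (le_antisymm this (sq_nonneg _))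

namespace QF

theorem ev_param (F : QF) (o u v : E3) (s t : ℝ) : F.ev (o + s • u + t • v) =
    F.B u u * s ^ 2 + (F.B u v + F.B v u) * s * t + F.B v v * t ^ 2 +
      (F.B o u + F.B u o + F.l u) * s + (F.B o v + F.B v o + F.l v) * t + F.ev o := by
  simp only [ev, map_add, map_smul, add_apply, smul_apply, smul_eq_mul]
  ring

theorem D_param (F : QF) (o u v : E3) (s t : ℝ) :
    F.D (o + s • u + t • v) (-t • u + s • v) =
    -t * (2 * F.B u u * s + (F.B u v + F.B v u) * t + (F.B o u + F.B u o + F.l u)) +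
      s * ((F.B u v + F.B v u) * s + 2 * F.B v v * t + (F.B o v + F.B v o + F.l v)) := by
  simp only [D_apply, map_add, map_smul, add_apply, smul_apply, smul_eq_mul]
  ring

end QF

namespace NormalBody

variable {K : Set E3} {η : E3 → E3}

/-- On an ellipse in the boundary, the normal is orthogonal to the tangent vector. -/
theorem tangent_orthogonal (hB : NormalBody K η) {z : E3 × ℝ} {o u v : E3}
    (hpar : ∀ y, y ∈ frontier K ∩ pl z ↔ ∃ s t : ℝ, s ^ 2 + t ^ 2 = 1 ∧ y = o + s • u + t • v)
    {s t : ℝ} (hst : s ^ 2 + t ^ 2 = 1) : ⟪η (o + s • u + t • v), -t • u + s • v⟫ = 0 := by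
  have hmem := fun x y hxy => (hpar (o + x • u + y • v)).2 ⟨x, y, hxy, rfl⟩
  have hf := (hmem s t hst).1
  rw [inner_add_right, inner_smul_right, inner_smul_right]
  refine tangential_eq_zero hst fun x y hxy => ?_
  have := hB.normal_le hf (hB.mem_of_frontier (hmem x y hxy).1)
  simp only [inner_add_right, inner_smul_right] at this ⊢
  linarith

/-- Five zeros on an elliptic section, the first possibly double, force vanishing. -/
theorem QP_of_five (hB : NormalBody K η) {F : QF} {z : E3 × ℝ}
    (hE : IsEllipse (frontier K ∩ pl z)) {a₁ a₂ a₃ a₄ : E3}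
    (h12 : a₁ ≠ a₂) (h13 : a₁ ≠ a₃) (h14 : a₁ ≠ a₄) (h23 : a₂ ≠ a₃) (h24 : a₂ ≠ a₄)
    (h34 : a₃ ≠ a₄)
    (h1 : a₁ ∈ frontier K ∩ pl z ∧ F.ev a₁ = 0) (h2 : a₂ ∈ frontier K ∩ pl z ∧ F.ev a₂ = 0)
    (h3 : a₃ ∈ frontier K ∩ pl z ∧ F.ev a₃ = 0) (h4 : a₄ ∈ frontier K ∩ pl z ∧ F.ev a₄ = 0)
    (h5 : (∃ b, b ≠ a₁ ∧ b ≠ a₂ ∧ b ≠ a₃ ∧ b ≠ a₄ ∧ b ∈ frontier K ∩ pl z ∧ F.ev b = 0) ∨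
      ∀ v, ⟪η a₁, v⟫ = 0 → F.D a₁ v = 0) : QP K F z := by
  obtain ⟨o, u, v, -, hpar⟩ := hE.exists_param
  obtain ⟨s₁, t₁, c₁, e₁⟩ := (hpar a₁).1 h1.1
  obtain ⟨s₂, t₂, c₂, e₂⟩ := (hpar a₂).1 h2.1
  obtain ⟨s₃, t₃, c₃, e₃⟩ := (hpar a₃).1 h3.1
  obtain ⟨s₄, t₄, c₄, e₄⟩ := (hpar a₄).1 h4.1
  have hne : ∀ {a a' : E3} {s t s' t' : ℝ}, a ≠ a' → a = o + s • u + t • v →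
      a' = o + s' • u + t' • v → (s, t) ≠ (s', t') := by
    intro a a' s t s' t' h ha ha' heq
    rw [Prod.mk.injEq] at heq
    apply h
    rw [ha, ha', heq.1, heq.2]
  intro y hy hyz
  obtain ⟨s, t, c, rfl⟩ := (hpar y).1 ⟨hy, hyz⟩
  rw [F.ev_param]
  refine circle_quadratic_eq_zero (p₁ := (s₁, t₁)) (p₂ := (s₂, t₂)) (p₃ := (s₃, t₃))
    (p₄ := (s₄, t₄)) (hne h12 e₁ e₂) (hne h13 e₁ e₃) (hne h14 e₁ e₄) (hne h23 e₂ e₃)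
    (hne h24 e₂ e₄) (hne h34 e₃ e₄) ?_ ?_ c
  · rintro p (rfl | rfl | rfl | rfl)
    · exact ⟨c₁, by rw [← F.ev_param, ← e₁]; exact h1.2⟩
    · exact ⟨c₂, by rw [← F.ev_param, ← e₂]; exact h2.2⟩
    · exact ⟨c₃, by rw [← F.ev_param, ← e₃]; exact h3.2⟩
    · exact ⟨c₄, by rw [← F.ev_param, ← e₄]; exact h4.2⟩
  · rcases h5 with ⟨b, b1, b2, b3, b4, hb, hb0⟩ | h5
    · left
      obtain ⟨s₅, t₅, c₅, e₅⟩ := (hpar b).1 hb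
      exact ⟨(s₅, t₅), hne b1 e₅ e₁, hne b2 e₅ e₂, hne b3 e₅ e₃, hne b4 e₅ e₄, c₅,
        by rw [← F.ev_param, ← e₅]; exact hb0⟩
    · right
      rw [← F.D_param, ← e₁]
      apply h5
      have := hB.tangent_orthogonal hpar c₁
      rwa [← e₁] at this

end NormalBody

namespace NormalBody

variable {K : Set E3} {η : E3 → E3}

/-- Two planes meeting in the interior share two boundary points. -/
theorem exists_two_common (hB : NormalBody K η) {z w : E3 × ℝ}
    (h : (pl z ∩ pl w ∩ interior K).Nonempty) :
    ∃ a a' : E3, a ≠ a' ∧ a ∈ frontier K ∧ a' ∈ frontier K ∧ a ∈ pl z ∧ a' ∈ pl z ∧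
      a ∈ pl w ∧ a' ∈ pl w := by
  obtain ⟨x, ⟨hxz, hxw⟩, hxi⟩ := h
  obtain ⟨e, he, hez, hew⟩ := exists_orthogonal_pair z.1 w.1
  obtain ⟨t, ht, hta⟩ := hB.exits hxi he
  obtain ⟨s, hs, hsa⟩ := hB.exits hxi (neg_ne_zero.2 he)
  rw [mem_pl] at hxz hxw
  refine ⟨_, _, ?_, hta, hsa, ?_, ?_, ?_, ?_⟩
  · intro heq
    have : (t + s) • e = 0 := by
      have := add_left_cancel heq
      rw [add_smul, this]; simp
    rcases smul_eq_zero.1 this with h | h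
    · linarith
    · exact he h
  all_goals simp [mem_pl, inner_add_right, inner_smul_right, hxz, hxw, hez, hew]

/-- A quadratic vanishing on three sections vanishes on an elliptic section in general position. -/
theorem QP_of_three (hB : NormalBody K η) {F : QF} {J A B C : E3 × ℝ}
    (hJ : IsEllipse (frontier K ∩ pl J)) (hA : QP K F A) (hC : QP K F C) (hBF : QP K F B)
    (nA : ‖A.1‖ = 1) (nB : ‖B.1‖ = 1) (nC : ‖C.1‖ = 1)
    (hJA : (pl J ∩ pl A ∩ interior K).Nonempty) (hJC : (pl J ∩ pl C ∩ interior K).Nonempty)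
    (hJAC : pl J ∩ pl A ∩ pl C ∩ frontier K = ∅) (hBA : pl B ≠ pl A) (hBC : pl B ≠ pl C)
    (hBCi : (pl B ∩ pl C ∩ interior K).Nonempty) {b : E3} (hb : b ∈ frontier K)
    (hbB : b ∈ pl B) (hbJ : b ∈ pl J) (hbA : b ∈ pl A → (pl B ∩ pl A ∩ interior K).Nonempty) :
    QP K F J := by
  obtain ⟨a, a', haa, haf, haf', haJ, haJ', haA, haA'⟩ := hB.exists_two_common hJA
  obtain ⟨c, c', hcc, hcf, hcf', hcJ, hcJ', hcC, hcC'⟩ := hB.exists_two_common hJC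
  have hdis : ∀ {x y : E3}, x ∈ frontier K → x ∈ pl J → x ∈ pl A → y ∈ pl C → x ≠ y := by
    rintro x y hx hxJ hxA hyC rfl
    have : x ∈ pl J ∩ pl A ∩ pl C ∩ frontier K := ⟨⟨⟨hxJ, hxA⟩, hyC⟩, hx⟩
    simp [hJAC] at this
  have h13 : a ≠ c := hdis haf haJ haA hcC
  have h14 : a ≠ c' := hdis haf haJ haA hcC'
  have h23 : a' ≠ c := hdis haf' haJ' haA' hcC
  have h24 : a' ≠ c' := hdis haf' haJ' haA' hcC'
  have z1 : a ∈ frontier K ∩ pl J ∧ F.ev a = 0 := ⟨⟨haf, haJ⟩, hA a haf haA⟩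
  have z2 : a' ∈ frontier K ∩ pl J ∧ F.ev a' = 0 := ⟨⟨haf', haJ'⟩, hA a' haf' haA'⟩
  have z3 : c ∈ frontier K ∩ pl J ∧ F.ev c = 0 := ⟨⟨hcf, hcJ⟩, hC c hcf hcC⟩
  have z4 : c' ∈ frontier K ∩ pl J ∧ F.ev c' = 0 := ⟨⟨hcf', hcJ'⟩, hC c' hcf' hcC'⟩
  have tA : b ∈ pl A → ∀ v, ⟪η b, v⟫ = 0 → F.D b v = 0 := fun h v hv =>
    hB.D_eq_zero_of_two hBF hA nB nA hBA (hbA h) hb hbB h hv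
  have tC : b ∈ pl C → ∀ v, ⟪η b, v⟫ = 0 → F.D b v = 0 := fun h v hv =>
    hB.D_eq_zero_of_two hBF hC nB nC hBC hBCi hb hbB h hv
  by_cases e1 : b = a
  · subst e1
    exact hB.QP_of_five hJ haa h13 h14 h23 h24 hcc z1 z2 z3 z4 (Or.inr (tA haA))
  by_cases e2 : b = a'
  · subst e2
    exact hB.QP_of_five hJ haa.symm h23 h24 h13 h14 hcc z2 z1 z3 z4 (Or.inr (tA haA'))
  by_cases e3 : b = c
  · subst e3
    exact hB.QP_of_five hJ hcc h13.symm h23.symm h14.symm h24.symm haa z3 z4 z1 z2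
      (Or.inr (tC hcC))
  by_cases e4 : b = c'
  · subst e4
    exact hB.QP_of_five hJ hcc.symm h14.symm h24.symm h13.symm h23.symm haa z4 z3 z1 z2
      (Or.inr (tC hcC'))
  exact hB.QP_of_five hJ haa h13 h14 h23 h24 hcc z1 z2 z3 z4
    (Or.inl ⟨b, e1, e2, e3, e4, ⟨hb, hbJ⟩, hBF b hb hbB⟩)

/-- Variant of `QP_of_three` where the third plane meets the section transversally. -/
theorem QP_of_three_meet (hB : NormalBody K η) {F : QF} {J A B C : E3 × ℝ}
    (hJ : IsEllipse (frontier K ∩ pl J)) (hA : QP K F A) (hC : QP K F C) (hBF : QP K F B)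
    (nA : ‖A.1‖ = 1) (nB : ‖B.1‖ = 1) (nC : ‖C.1‖ = 1)
    (hJA : (pl J ∩ pl A ∩ interior K).Nonempty) (hJC : (pl J ∩ pl C ∩ interior K).Nonempty)
    (hJAC : pl J ∩ pl A ∩ pl C ∩ frontier K = ∅) (hBA : pl B ≠ pl A) (hBC : pl B ≠ pl C)
    (hBCi : (pl B ∩ pl C ∩ interior K).Nonempty)
    (hBJ : (pl B ∩ pl J ∩ interior K).Nonempty) : QP K F J := by
  obtain ⟨b, b', hbb, hbf, hbf', hbB, hbB', hbJ, hbJ'⟩ := hB.exists_two_common hBJ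
  have key : ∀ {b}, b ∈ frontier K → b ∈ pl B → b ∈ pl J →
      (b ∈ pl A → (pl B ∩ pl A ∩ interior K).Nonempty) → QP K F J :=
    fun h1 h2 h3 h4 => hB.QP_of_three hJ hA hC hBF nA nB nC hJA hJC hJAC hBA hBC hBCi h1 h2 h3 h4
  by_cases h : b ∈ pl A
  · by_cases h' : b' ∈ pl A
    · exact key hbf hbB hbJ fun _ => hB.meet_of_two hbf hbf' hbb hbB hbB' h h'
    · exact key hbf' hbB' hbJ' fun x => absurd x h'
  · exact key hbf hbB hbJ fun x => absurd x h

/-- Meeting in the interior is stable under perturbing a plane. -/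
theorem eventually_meet {K : Set E3} {N A : E3 × ℝ} (hN : ‖N.1‖ = 1)
    (hA : ‖A.1‖ = 1) (h1 : N.1 ≠ A.1) (h2 : N.1 ≠ -A.1)
    (h : (pl N ∩ pl A ∩ interior K).Nonempty) :
    ∀ᶠ z in 𝓝 N, (pl z ∩ pl A ∩ interior K).Nonempty := by
  obtain ⟨w, ⟨hwN, hwA⟩, hwi⟩ := h
  rw [mem_pl] at hwN hwA
  set u : E3 := N.1 - ⟪N.1, A.1⟫ • A.1 with hu
  have hAu : ⟪A.1, u⟫ = 0 := by
    rw [hu, inner_sub_right, inner_smul_right, real_inner_self_eq_norm_sq, hA, real_inner_comm]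
    ring
  have hNu : ⟪N.1, u⟫ ≠ 0 := by
    rw [hu, inner_sub_right, inner_smul_right, real_inner_self_eq_norm_sq, hN]
    have := abs_inner_lt_one hN hA h1 h2
    have := (sq_lt_one_iff_abs_lt_one _).2 this
    nlinarith
  have hc : ContinuousAt (fun z : E3 × ℝ => w + ((z.2 - ⟪z.1, w⟫) / ⟪z.1, u⟫) • u) N := by
    fun_prop (disch := exact hNu)
  have e1 : ∀ᶠ z in 𝓝 N, w + ((z.2 - ⟪z.1, w⟫) / ⟪z.1, u⟫) • u ∈ interior K := by
    refine hc.eventually (isOpen_interior.mem_nhds ?_)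
    simpa [hwN] using hwi
  have e2 : ∀ᶠ z : E3 × ℝ in 𝓝 N, ⟪z.1, u⟫ ≠ 0 := by
    have : ContinuousAt (fun z : E3 × ℝ => ⟪z.1, u⟫) N := by fun_prop
    exact this.eventually_ne hNu
  filter_upwards [e1, e2] with z h1 h2
  refine ⟨_, ⟨?_, ?_⟩, h1⟩
  · rw [mem_pl, inner_add_right, inner_smul_right]
    field_simp
    ring
  · rw [mem_pl, inner_add_right, inner_smul_right, hAu, hwA]
    ring

/-- Having no common boundary point with a fixed pair of planes is stable. -/
theorem eventually_disjoint (hB : NormalBody K η) {N A C : E3 × ℝ}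
    (h : pl N ∩ pl A ∩ pl C ∩ frontier K = ∅) :
    ∀ᶠ z in 𝓝 N, pl z ∩ pl A ∩ pl C ∩ frontier K = ∅ := by
  have hcl : ∀ z : E3 × ℝ, IsClosed (pl z) := fun z =>
    isClosed_eq (by fun_prop) continuous_const
  have hcomp : IsCompact (frontier K ∩ (pl A ∩ pl C)) :=
    (hB.compact.of_isClosed_subset isClosed_frontier hB.closed.frontier_subset).inter_right
      ((hcl A).inter (hcl C))
  have := hcomp.eventually_forall_of_forall_eventually (x₀ := N)
    (P := fun z y => y ∉ pl z) (fun y hy => by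
      have hne : ⟪N.1, y⟫ - N.2 ≠ 0 := by
        intro h0
        have : y ∈ pl N ∩ pl A ∩ pl C ∩ frontier K :=
          ⟨⟨⟨by rw [mem_pl]; linarith, hy.2.1⟩, hy.2.2⟩, hy.1⟩
        simp [h] at this
      have hc : ContinuousAt (fun q : (E3 × ℝ) × E3 => ⟪q.1.1, q.2⟫ - q.1.2) (N, y) := by fun_prop
      have := hc.eventually_ne hne
      filter_upwards [this] with q hq hq'
      exact hq (by rw [mem_pl.1 hq']; ring))
  filter_upwards [this] with z hz
  rw [eq_empty_iff_forall_notMem]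
  rintro y ⟨⟨⟨h1, h2⟩, h3⟩, h4⟩
  exact hz y ⟨h4, h2, h3⟩ h1

end NormalBody

theorem pl_ne_of_ne {a b : E3} {c d : ℝ} (ha : ‖a‖ = 1) (hb : ‖b‖ = 1) (h1 : a ≠ b)
    (h2 : a ≠ -b) : pl (a, c) ≠ pl (b, d) := by
  intro h
  have e2 : ⟪b, b⟫ = 1 := by rw [real_inner_self_eq_norm_sq, hb]; norm_num
  have m1 : c • a ∈ pl (a, c) := by simp [mem_pl, inner_smul_right, ha]
  have m2 : c • a + (b - ⟪a, b⟫ • a) ∈ pl (a, c) := by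
    simp [mem_pl, inner_smul_right, inner_add_right, inner_sub_right, ha]
  rw [h, mem_pl] at m1 m2
  rw [inner_add_right, m1, inner_sub_right, inner_smul_right, e2, real_inner_comm] at m2
  have := (sq_lt_one_iff_abs_lt_one _).2 (abs_inner_lt_one ha hb h1 h2)
  rw [real_inner_comm] at this
  simp only at m2
  nlinarith

theorem eventually_fst_ne {N : E3 × ℝ} {n : E3} (h1 : N.1 ≠ n) (h2 : N.1 ≠ -n) :
    ∀ᶠ z in 𝓝 N, z.1 ≠ n ∧ z.1 ≠ -n :=
  (continuous_fst.continuousAt.eventually_ne h1).and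
    (continuous_fst.continuousAt.eventually_ne h2)

/-- The plane through `p` with normal `n`. -/
noncomputable def thru (p n : E3) : E3 × ℝ := (n, ⟪n, p⟫)

theorem mem_thru {p n x : E3} : x ∈ pl (thru p n) ↔ ⟪n, x⟫ = ⟪n, p⟫ := Iff.rfl

theorem self_mem_thru (p n : E3) : p ∈ pl (thru p n) := rfl

theorem pl_thru_neg (p n : E3) : pl (thru p (-n)) = pl (thru p n) := by
  ext x
  simp [mem_thru]

theorem thru_eq_of_mem {p q n : E3} (h : q ∈ pl (thru p n)) : thru q n = thru p n := by
  rw [mem_thru] at h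
  rw [thru, thru, h]

/-- The quadratic vanishes on the boundary near `p`. -/
def Om (K : Set E3) (F : QF) (p : E3) : Prop := ∀ᶠ x in 𝓝[frontier K] p, F.ev x = 0

/-- Two fields of unit normals to elliptic normal sections, uniformly transversal. -/
structure EllField (K : Set E3) (η : E3 → E3) (ν : Fin 2 → E3 → E3) (κ : ℝ) : Prop where
  lt : κ < 1
  unit : ∀ p ∈ frontier K, ∀ i, ‖ν i p‖ = 1
  orth : ∀ p ∈ frontier K, ∀ i, ⟪ν i p, η p⟫ = 0
  angle : ∀ p ∈ frontier K, |⟪ν 0 p, ν 1 p⟫| ≤ κ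
  ell : ∀ p ∈ frontier K, ∀ i, IsEllipse (frontier K ∩ pl (thru p (ν i p)))

/-- Two unit vectors orthogonal to the normal at `p` and not parallel. -/
structure NPair (η : E3 → E3) (p : E3) (N : Fin 2 → E3) : Prop where
  unit : ∀ i, ‖N i‖ = 1
  orth : ∀ i, ⟪N i, η p⟫ = 0
  ne : N 0 ≠ N 1
  ne' : N 0 ≠ -N 1

theorem NPair.pick {η : E3 → E3} {p : E3} {N : Fin 2 → E3} (h : NPair η p N) (n : E3) :
    ∃ i, N i ≠ n ∧ N i ≠ -n := by
  by_contra! hc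
  have h0 := hc 0
  have h1 := hc 1
  by_cases a : N 0 = n
  · by_cases b : N 1 = n
    · exact h.ne (a.trans b.symm)
    · exact h.ne' (by rw [h1 b, a, neg_neg])
  · by_cases b : N 1 = n
    · exact h.ne' (by rw [h0 a, b])
    · exact h.ne ((h0 a).trans (h1 b).symm)

theorem EllField.ne {K : Set E3} {η : E3 → E3} {ν : Fin 2 → E3 → E3} {κ : ℝ}
    (hν : EllField K η ν κ) {p : E3} (hp : p ∈ frontier K) : NPair η p (fun i => ν i p) := by
  refine ⟨hν.unit p hp, hν.orth p hp, ?_, ?_⟩ <;> intro h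
  · have := hν.angle p hp
    rw [h, real_inner_self_eq_norm_sq, hν.unit p hp] at this
    have := hν.lt
    norm_num at *
    linarith
  · have := hν.angle p hp
    rw [h, inner_neg_left, real_inner_self_eq_norm_sq, hν.unit p hp] at this
    have := hν.lt
    norm_num at *
    linarith

namespace NormalBody

variable {K : Set E3} {η : E3 → E3} {ν : Fin 2 → E3 → E3} {κ : ℝ}

theorem exists_limit (hB : NormalBody K η) (hν : EllField K η ν κ) {p : E3}
    (hp : p ∈ frontier K) {U : Ultrafilter E3} (hU : (U : Filter E3) ≤ 𝓝[frontier K] p) :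
    ∃ N : Fin 2 → E3, NPair η p N ∧
      ∀ i, Tendsto (fun x => thru x (ν i x)) (U : Filter E3) (𝓝 (thru p (N i))) := by
  have hUf : ∀ᶠ x in (U : Filter E3), x ∈ frontier K := hU self_mem_nhdsWithin
  have hUp : Tendsto id (U : Filter E3) (𝓝 p) := hU.trans nhdsWithin_le_nhds
  have hη : Tendsto η (U : Filter E3) (𝓝 (η p)) := (hB.normal_continuousOn p hp).mono_left hU
  have hlim : ∀ i, ∃ n, ‖n‖ = 1 ∧ Tendsto (ν i) (U : Filter E3) (𝓝 n) := by
    intro i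
    have hmap : ((U.map (ν i) : Ultrafilter E3) : Filter E3) ≤ 𝓟 (Metric.sphere (0 : E3) 1) := by
      rw [le_principal_iff]
      show ∀ᶠ x in (U : Filter E3), ν i x ∈ Metric.sphere (0 : E3) 1
      filter_upwards [hUf] with x hx
      simp [hν.unit x hx i]
    obtain ⟨n, hn, hn'⟩ := (isCompact_sphere (0 : E3) 1).ultrafilter_le_nhds _ hmap
    exact ⟨n, by simpa using hn, hn'⟩
  choose N hN hN' using hlim
  have horth : ∀ i, ⟪N i, η p⟫ = 0 := by
    intro i
    have h1 : Tendsto (fun x => ⟪ν i x, η x⟫) (U : Filter E3) (𝓝 ⟪N i, η p⟫) := (hN' i).inner hη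
    refine tendsto_nhds_unique (h1.congr' ?_) tendsto_const_nhds
    filter_upwards [hUf] with x hx using hν.orth x hx i
  have hang : |⟪N 0, N 1⟫| ≤ κ := by
    have h1 : Tendsto (fun x => |⟪ν 0 x, ν 1 x⟫|) (U : Filter E3) (𝓝 |⟪N 0, N 1⟫|) :=
      ((hN' 0).inner (hN' 1)).abs
    refine le_of_tendsto h1 ?_
    filter_upwards [hUf] with x hx using hν.angle x hx
  have hlt := hν.lt
  refine ⟨N, ⟨hN, horth, ?_, ?_⟩, fun i => ?_⟩
  · intro h
    rw [h, real_inner_self_eq_norm_sq, hN] at hang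
    norm_num at hang
    linarith
  · intro h
    rw [h, inner_neg_left, real_inner_self_eq_norm_sq, hN] at hang
    norm_num at hang
    linarith
  · exact (hN' i).prodMk_nhds ((hN' i).inner hUp)

end NormalBody

/-- A quadratic vanishing on two normal sections at `p` and on a section by a plane through an
interior point `m` of the normal line and transversal to that line. -/
structure Frame (K : Set E3) (η : E3 → E3) (F : QF) (p : E3) (n : Fin 2 → E3) (g m : E3) (τ : ℝ) :
    Prop where
  hp : p ∈ frontier K
  pair : NPair η p n
  ug : ‖g‖ = 1
  gη : ⟪g, η p⟫ ≠ 0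
  hm : m ∈ interior K
  hτ : p = m + τ • η p
  q : ∀ i, QP K F (thru p (n i))
  qg : QP K F (thru m g)

namespace Frame

variable {K : Set E3} {η : E3 → E3} {F : QF} {p : E3} {n : Fin 2 → E3} {g m : E3} {τ : ℝ}

theorem ne_pair (hF : NPair η p n) {i j : Fin 2} (hij : i ≠ j) : n i ≠ n j ∧ n i ≠ -n j := by
  have h1 := hF.ne
  have h2 := hF.ne'
  fin_cases i <;> fin_cases j <;> simp at hij ⊢
  · exact ⟨h1, h2⟩
  · exact ⟨h1.symm, fun h => h2 (by rw [h, neg_neg])⟩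

theorem ne_g (hF : Frame K η F p n g m τ) {N : E3} (hN : ⟪N, η p⟫ = 0) : N ≠ g ∧ N ≠ -g := by
  refine ⟨?_, ?_⟩ <;> rintro rfl
  · exact hF.gη hN
  · apply hF.gη
    rwa [inner_neg_left, neg_eq_zero] at hN

theorem m_mem (hF : Frame K η F p n g m τ) {N : E3} (hN : ⟪N, η p⟫ = 0) : m ∈ pl (thru p N) := by
  rw [mem_thru]
  conv_rhs => rw [hF.hτ]
  rw [inner_add_right, inner_smul_right, hN]
  ring

theorem disjoint (hF : Frame K η F p n g m τ) {N : E3} {i : Fin 2} (hN : ‖N‖ = 1)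
    (hNη : ⟪N, η p⟫ = 0) (hη : ‖η p‖ = 1) (h1 : N ≠ n i) (h2 : N ≠ -n i) :
    pl (thru p N) ∩ pl (thru p (n i)) ∩ pl (thru m g) ∩ frontier K = ∅ := by
  rw [eq_empty_iff_forall_notMem]
  rintro y ⟨⟨⟨h3, h4⟩, h5⟩, h6⟩
  have m1 := hF.m_mem hNη
  have m2 := hF.m_mem (hF.pair.orth i)
  rw [mem_thru] at h3 h4 h5 m1 m2
  have := eq_smul_of_orthogonal hN (hF.pair.unit i) h1 h2 hη hNη (hF.pair.orth i) (x := y - m)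
    (by rw [inner_sub_right]; linarith) (by rw [inner_sub_right]; linarith)
  have hg : ⟪g, y - m⟫ = 0 := by rw [inner_sub_right]; linarith
  rw [this, inner_smul_right] at hg
  have h0 := (mul_eq_zero.1 hg).resolve_right hF.gη
  rw [h0, zero_smul, sub_eq_zero] at this
  subst this
  exact h6.2 hF.hm

theorem eventually_QP (hB : NormalBody K η) (hF : Frame K η F p n g m τ) {N : E3} {i : Fin 2}
    (hN : ‖N‖ = 1) (hNη : ⟪N, η p⟫ = 0) (h1 : N ≠ n i) (h2 : N ≠ -n i) :
    ∀ᶠ z in 𝓝 (thru p N), IsEllipse (frontier K ∩ pl z) → ∀ B : E3 × ℝ, ‖B.1‖ = 1 → QP K F B →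
      pl B ≠ pl (thru p (n i)) → pl B ≠ pl (thru m g) →
      (pl B ∩ pl (thru m g) ∩ interior K).Nonempty →
      ((∃ b ∈ frontier K, b ∈ pl B ∧ b ∈ pl z ∧ (b ∈ pl (thru p (n i)) →
        (pl B ∩ pl (thru p (n i)) ∩ interior K).Nonempty)) ∨
        (pl B ∩ pl z ∩ interior K).Nonempty) → QP K F z := by
  have e1 := NormalBody.eventually_meet (K := K) (N := thru p N) (A := thru p (n i)) hN
    (hF.pair.unit i) h1 h2 ⟨m, ⟨hF.m_mem hNη, hF.m_mem (hF.pair.orth i)⟩, hF.hm⟩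
  have e2 := NormalBody.eventually_meet (K := K) (N := thru p N) (A := thru m g) hN
    hF.ug (hF.ne_g hNη).1 (hF.ne_g hNη).2 ⟨m, ⟨hF.m_mem hNη, self_mem_thru m g⟩, hF.hm⟩
  have e3 := hB.eventually_disjoint (hF.disjoint hN hNη (hB.norm_normal hF.hp) h1 h2)
  filter_upwards [e1, e2, e3] with z z1 z2 z3 hz B nB qB b1 b2 b3 hb
  rcases hb with ⟨b, hb, hbB, hbz, hbA⟩ | hb
  · exact hB.QP_of_three hz (hF.q i) hF.qg qB (hF.pair.unit i) nB hF.ug z1 z2 z3 b1 b2 b3 hb hbB hbz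
      hbA
  · exact hB.QP_of_three_meet hz (hF.q i) hF.qg qB (hF.pair.unit i) nB hF.ug z1 z2 z3 b1 b2 b3 hb

variable {ν : Fin 2 → E3 → E3} {κ : ℝ}

theorem om_of_third (hB : NormalBody K η) (hν : EllField K η ν κ) (hF : Frame K η F p n g m τ)
    {B : E3 × ℝ} {i j : Fin 2} (hij : i ≠ j) (nB : ‖B.1‖ = 1) (qB : QP K F B)
    (b1 : pl B ≠ pl (thru p (n i)))
    (b2 : pl B ≠ pl (thru m g)) (b3 : (pl B ∩ pl (thru m g) ∩ interior K).Nonempty)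
    (b4 : (pl B ∩ pl (thru p (n j)) ∩ interior K).Nonempty) (b5 : B.1 ≠ n j) (b6 : B.1 ≠ -n j) :
    Om K F p := by
  rw [Om, Filter.Eventually, Filter.mem_iff_ultrafilter]
  intro U hU
  have hUf : ∀ᶠ x in (U : Filter E3), x ∈ frontier K := hU self_mem_nhdsWithin
  obtain ⟨N, hN, hNt⟩ := hB.exists_limit hν hF.hp hU
  obtain ⟨k, k1, k2⟩ := hN.pick (n i)
  have e1 := (hNt k).eventually (hF.eventually_QP hB (hN.unit k) (hN.orth k) k1 k2)
  obtain ⟨B', nB', qB', c1, c2, c3, c4⟩ : ∃ B' : E3 × ℝ, ‖B'.1‖ = 1 ∧ QP K F B' ∧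
      pl B' ≠ pl (thru p (n i)) ∧ pl B' ≠ pl (thru m g) ∧
      (pl B' ∩ pl (thru m g) ∩ interior K).Nonempty ∧
      ∀ᶠ z in 𝓝 (thru p (N k)), (pl B' ∩ pl z ∩ interior K).Nonempty := by
    have hji := ne_pair hF.pair hij.symm
    by_cases hk : N k ≠ n j ∧ N k ≠ -n j
    · refine ⟨thru p (n j), hF.pair.unit j, hF.q j,
        pl_ne_of_ne (hF.pair.unit j) (hF.pair.unit i) hji.1 hji.2,
        pl_ne_of_ne (hF.pair.unit j) hF.ug (hF.ne_g (hF.pair.orth j)).1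
          (hF.ne_g (hF.pair.orth j)).2,
        ⟨m, ⟨hF.m_mem (hF.pair.orth j), self_mem_thru m g⟩, hF.hm⟩, ?_⟩
      have := NormalBody.eventually_meet (K := K) (N := thru p (N k)) (A := thru p (n j))
        (hN.unit k) (hF.pair.unit j) hk.1 hk.2
        ⟨m, ⟨hF.m_mem (hN.orth k), hF.m_mem (hF.pair.orth j)⟩, hF.hm⟩
      filter_upwards [this] with z hz
      rwa [inter_comm (pl z)] at hz
    · refine ⟨B, nB, qB, b1, b2, b3, ?_⟩
      have hpl : pl (thru p (N k)) = pl (thru p (n j)) := by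
        by_cases h : N k = n j
        · rw [h]
        · have : N k = -n j := by
            by_contra h'
            exact hk ⟨h, h'⟩
          rw [this, pl_thru_neg]
      have hne : N k ≠ B.1 ∧ N k ≠ -B.1 := by
        by_cases h : N k = n j
        · rw [h]
          exact ⟨b5.symm, fun h' => b6 (by rw [h', neg_neg])⟩
        · have : N k = -n j := by
            by_contra h'
            exact hk ⟨h, h'⟩
          rw [this]
          exact ⟨b6.symm, fun h' => b5 (neg_injective h').symm⟩
      have := NormalBody.eventually_meet (K := K) (N := thru p (N k)) (A := B) (hN.unit k) nB hne.1
        hne.2 (by rwa [hpl, inter_comm (pl (thru p (n j)))])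
      filter_upwards [this] with z hz
      rwa [inter_comm (pl z)] at hz
  have e2 := (hNt k).eventually c4
  show ∀ᶠ x in (U : Filter E3), F.ev x = 0
  filter_upwards [hUf, e1, e2] with x hx h1 h2
  exact h1 (hν.ell x hx k) B' nB' qB' c1 c2 c3 (Or.inr h2) x hx (self_mem_thru x _)

theorem om_or_flat (hB : NormalBody K η) (hν : EllField K η ν κ) (hF : Frame K η F p n g m τ)
    (i : Fin 2) :
    Om K F p ∨ ∀ᶠ x in 𝓝[frontier K ∩ pl (thru p (n i))] p, ⟪n i, η x⟫ = 0 := by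
  obtain ⟨j, hij⟩ : ∃ j : Fin 2, i ≠ j := by
    fin_cases i
    · exact ⟨1, by simp⟩
    · exact ⟨0, by simp⟩
  by_contra! hcon
  obtain ⟨hno, hfr⟩ := hcon
  have hne := Filter.frequently_iff_neBot.1 hfr
  obtain ⟨U, hUle⟩ : ∃ U : Ultrafilter E3, (U : Filter E3) ≤
      𝓝[frontier K ∩ pl (thru p (n i))] p ⊓ 𝓟 {x | ¬⟪n i, η x⟫ = 0} := ⟨_, Ultrafilter.of_le _⟩
  have hU : (U : Filter E3) ≤ 𝓝[frontier K] p :=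
    (hUle.trans inf_le_left).trans (nhdsWithin_mono _ inter_subset_left)
  have hUf : ∀ᶠ x in (U : Filter E3), x ∈ frontier K ∩ pl (thru p (n i)) :=
    (hUle.trans inf_le_left) self_mem_nhdsWithin
  have hUn : ∀ᶠ x in (U : Filter E3), ¬ ⟪n i, η x⟫ = 0 :=
    (hUle.trans inf_le_right) (mem_principal_self _)
  obtain ⟨N, hN, hNt⟩ := hB.exists_limit hν hF.hp hU
  obtain ⟨k, k1, k2⟩ := hN.pick (n j)
  have hpi := ne_pair hF.pair hij
  have hgk := hF.ne_g (hN.orth k)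
  have e1 := (hNt k).eventually (hF.eventually_QP hB (hN.unit k) (hN.orth k) k1 k2)
  have e2 := (hNt k).eventually (NormalBody.eventually_meet (K := K) (A := thru p (n j))
        (hN.unit k) (hF.pair.unit j) k1 k2
        ⟨m, ⟨hF.m_mem (hN.orth k), hF.m_mem (hF.pair.orth j)⟩, hF.hm⟩)
  have e3 := (hNt k).eventually (NormalBody.eventually_meet (K := K) (A := thru m g)
        (hN.unit k) hF.ug hgk.1 hgk.2
        ⟨m, ⟨hF.m_mem (hN.orth k), self_mem_thru m g⟩, hF.hm⟩)
  have e4 := (hNt k).eventually (eventually_fst_ne (N := thru p (N k)) k1 k2)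
  have e5 := (hNt k).eventually (eventually_fst_ne (N := thru p (N k)) hgk.1 hgk.2)
  obtain ⟨x, ⟨⟨⟨⟨⟨⟨hx, hxn⟩, x1⟩, x2⟩, x3⟩, x4⟩, x5⟩⟩ :=
    ((((((hUf.and hUn).and e1).and e2).and e3).and e4).and e5).exists
  have hgi := hF.ne_g (hF.pair.orth i)
  have qx : QP K F (thru x (ν k x)) := by
    refine x1 (hν.ell x hx.1 k) (thru p (n i)) (hF.pair.unit i) (hF.q i)
      (pl_ne_of_ne (hF.pair.unit i) (hF.pair.unit j) hpi.1 hpi.2)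
      (pl_ne_of_ne (hF.pair.unit i) hF.ug hgi.1 hgi.2)
      ⟨m, ⟨hF.m_mem (hF.pair.orth i), self_mem_thru m g⟩, hF.hm⟩
      (Or.inl ⟨x, hx.1, hx.2, self_mem_thru x _, fun _ =>
        ⟨m, ⟨hF.m_mem (hF.pair.orth i), hF.m_mem (hF.pair.orth j)⟩, hF.hm⟩⟩)
  refine hno (hF.om_of_third hB hν (B := thru x (ν k x)) hij (hν.unit x hx.1 k) qx ?_ ?_ x3 x2 x4.1 x4.2)
  · refine pl_ne_of_ne (hν.unit x hx.1 k) (hF.pair.unit i) ?_ ?_ <;> intro h <;> apply hxn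
    · rw [← h]; exact hν.orth x hx.1 k
    · have := hν.orth x hx.1 k
      rw [h, inner_neg_left] at this
      linarith
  · exact pl_ne_of_ne (hν.unit x hx.1 k) hF.ug x5.1 x5.2

end Frame

namespace NormalBody

variable {K : Set E3} {η : E3 → E3} {ν : Fin 2 → E3 → E3} {κ : ℝ}

theorem inner_normal_self (hB : NormalBody K η) {p : E3} (hp : p ∈ frontier K) :
    ⟪η p, η p⟫ = 1 := by
  rw [real_inner_self_eq_norm_sq, hB.norm_normal hp]; norm_num

/-- The normal line at a boundary point cuts the body in a chord. -/
theorem exists_normal_chord (hB : NormalBody K η) {p : E3} (hp : p ∈ frontier K) :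
    ∃ ℓ : ℝ, 0 < ℓ ∧ p + (-ℓ) • η p ∈ frontier K ∧
      ∀ s : ℝ, 0 < s → s < ℓ → p + (-s) • η p ∈ interior K := by
  obtain ⟨t, ht, hti⟩ := hB.inward (u := -η p) hp
    (by rw [inner_neg_right, hB.inner_normal_self hp]; norm_num)
  have hne : -η p ≠ 0 := by
    rw [neg_ne_zero, ← norm_ne_zero_iff, hB.norm_normal hp]; norm_num
  obtain ⟨s, hs, hsf⟩ := hB.exits (hti t ht le_rfl) hne
  have e : ∀ s : ℝ, p + t • -η p + s • -η p = p + (-(t + s)) • η p := by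
    intro s
    module
  refine ⟨t + s, by linarith, ?_, ?_⟩
  · rwa [← e]
  · intro r hr hrs
    by_cases h : r ≤ t
    · have := hti r hr h
      rwa [smul_neg, ← neg_smul] at this
    · push Not at h
      have := hB.interior_of_between (hti t ht le_rfl) (hB.mem_of_frontier hsf) (s := r - t)
        (by linarith) (by linarith)
      rw [e] at this
      convert this using 4
      ring

theorem line_frontier (hB : NormalBody K η) {p : E3} (hp : p ∈ frontier K) {ℓ s : ℝ} (hℓ : 0 < ℓ)
    (h : p + (-ℓ) • η p ∈ frontier K)
    (hi : ∀ s : ℝ, 0 < s → s < ℓ → p + (-s) • η p ∈ interior K)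
    (hs : p + s • η p ∈ frontier K) : s = 0 ∨ s = -ℓ := by
  rcases lt_trichotomy s 0 with h0 | h0 | h0
  · right
    rcases lt_trichotomy s (-ℓ) with h1 | h1 | h1
    · exfalso
      have := hB.interior_of_between (hi (ℓ / 2) (by linarith) (by linarith)) (e := -η p)
        (t := -s - ℓ / 2) (s := ℓ - ℓ / 2) (by
          convert hB.mem_of_frontier hs using 1; module) (by linarith) (by linarith)
      apply h.2
      convert this using 1
      module
    · exact h1
    · exfalso
      have := hi (-s) (by linarith) (by linarith)
      rw [neg_neg] at this
      exact hs.2 this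
  · exact Or.inl h0
  · exact absurd (hB.mem_of_frontier hs)
      (hB.outside hp (by rw [hB.inner_normal_self hp]; norm_num) h0)

theorem not_interior_of_max (n : E3) (hn : n ≠ 0) {q : E3} (h : ∀ x ∈ K, ⟪n, x⟫ ≤ ⟪n, q⟫) :
    q ∉ interior K := by
  intro hq
  have hcont : Tendsto (fun t : ℝ => q + t • n) (𝓝[>] 0) (𝓝 q) := by
    have : Continuous (fun t : ℝ => q + t • n) := by fun_prop
    have h := this.tendsto 0
    simp only [zero_smul, add_zero] at h
    exact h.mono_left nhdsWithin_le_nhds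
  obtain ⟨t, ht, ht0⟩ :=
    ((hcont.eventually (isOpen_interior.mem_nhds hq)).and self_mem_nhdsWithin).exists
  have := h _ (interior_subset ht)
  rw [inner_add_right, inner_smul_right, real_inner_self_eq_norm_sq] at this
  have ht0' : (0 : ℝ) < t := ht0
  have := mul_pos ht0' (pow_pos (norm_pos_iff.2 hn) 2)
  linarith

theorem normal_of_farthest (hB : NormalBody K η) {m q : E3} (hq : q ∈ K) (hne : q ≠ m)
    (h : ∀ x ∈ K, ‖x - m‖ ≤ ‖q - m‖) : q ∈ frontier K ∧ q = m + ‖q - m‖ • η q := by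
  have hpos : 0 < ‖q - m‖ := norm_pos_iff.2 (sub_ne_zero.2 hne)
  have hle : ∀ x ∈ K, ⟪q - m, x⟫ ≤ ⟪q - m, q⟫ := by
    intro x hx
    have h1 := real_inner_le_norm (q - m) (x - m)
    have h2 := mul_le_mul_of_nonneg_left (h x hx) hpos.le
    have h3 := real_inner_self_eq_norm_sq (q - m)
    rw [inner_sub_right] at h1 h3
    nlinarith
  have hf := hB.mem_frontier hq (not_interior_of_max _ (sub_ne_zero.2 hne) hle)
  refine ⟨hf, ?_⟩
  have := hB.normal_unique (n := ‖q - m‖⁻¹ • (q - m)) hf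
    (by rw [norm_smul, norm_inv, norm_norm, inv_mul_cancel₀ hpos.ne'])
    (fun x hx => by
      rw [real_inner_smul_left, real_inner_smul_left]
      exact mul_le_mul_of_nonneg_left (hle x hx) (by positivity))
  rw [← this, smul_smul, mul_inv_cancel₀ hpos.ne', one_smul]
  abel

theorem normal_of_nearest (hB : NormalBody K η) {m q : E3} (hm : m ∈ interior K)
    (hq : q ∈ frontier K) (h : ∀ x ∈ frontier K, ‖q - m‖ ≤ ‖x - m‖) :
    q = m + ‖q - m‖ • η q := by
  set d := ‖q - m‖ with hd
  have hne : q ≠ m := by rintro rfl; exact hq.2 hm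
  have hpos : 0 < d := norm_pos_iff.2 (sub_ne_zero.2 hne)
  have hball : Metric.ball m d ⊆ K := by
    intro y hy
    by_contra hyK
    obtain ⟨x, hx, hxf⟩ := exists_frontier_of_preconnected
      (convex_ball m d).isPreconnected ⟨m, Metric.mem_ball_self hpos, hm⟩ ⟨y, hy, hyK⟩ hB.closed
    have := h x hxf
    rw [Metric.mem_ball, dist_eq_norm] at hx
    linarith
  have hle : d ≤ ⟪η q, q - m⟫ := by
    refine le_of_forall_lt_imp_le_of_dense fun s hs => ?_
    by_cases hs0 : s ≤ -d
    · have := neg_le_of_abs_le (abs_real_inner_le_norm (η q) (q - m))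
      rw [hB.norm_normal hq, one_mul] at this
      linarith
    · push Not at hs0
      have hy : m + s • η q ∈ K := hball (by
        rw [Metric.mem_ball, dist_eq_norm, add_sub_cancel_left, norm_smul, hB.norm_normal hq,
          mul_one, Real.norm_eq_abs, abs_lt]
        exact ⟨hs0, hs⟩)
      have := hB.normal_le hq hy
      rw [inner_add_right, inner_smul_right, hB.inner_normal_self hq] at this
      rw [inner_sub_right]
      linarith
  have h0 : ‖(q - m) - d • η q‖ ^ 2 ≤ 0 := by
    rw [norm_sub_sq_real, inner_smul_right, norm_smul, hB.norm_normal hq, real_inner_comm,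
      Real.norm_eq_abs, mul_one, sq_abs, ← hd]
    nlinarith
  have : ‖(q - m) - d • η q‖ = 0 := by
    have := norm_nonneg ((q - m) - d • η q)
    nlinarith
  have := norm_eq_zero.1 this
  rw [sub_eq_zero] at this
  rw [← this]
  abel

/-- Through some interior point of the normal line at `p` there is a boundary normal line of
another direction. -/
theorem exists_other_normal (hB : NormalBody K η) {p : E3} (hp : p ∈ frontier K) :
    ∃ (m q : E3) (τ σ : ℝ), m ∈ interior K ∧ p = m + τ • η p ∧ q ∈ frontier K ∧
      q = m + σ • η q ∧ ∀ s : ℝ, q ≠ p + s • η p := by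
  obtain ⟨ℓ, hℓ, hf, hi⟩ := hB.exists_normal_chord hp
  set m := p + (-(ℓ / 2)) • η p with hm
  have hmi : m ∈ interior K := hi _ (by linarith) (by linarith)
  have hpm : p = m + (ℓ / 2) • η p := by rw [hm]; module
  have hdist : ∀ s : ℝ, ‖p + s • η p - m‖ = |s + ℓ / 2| := by
    intro s
    have : p + s • η p - m = (s + ℓ / 2) • η p := by rw [hm]; module
    rw [this, norm_smul, hB.norm_normal hp, mul_one, Real.norm_eq_abs]
  have hon : ∀ s : ℝ, p + s • η p ∈ frontier K → ‖p + s • η p - m‖ = ℓ / 2 := by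
    intro s hs
    rw [hdist]
    rcases hB.line_frontier hp hℓ hf hi hs with rfl | rfl
    · rw [zero_add, abs_of_pos (by linarith)]
    · rw [abs_of_neg (by linarith)]; ring
  obtain ⟨q, hqK, hqmax⟩ := hB.compact.exists_isMaxOn ⟨p, hB.mem_of_frontier hp⟩
    (f := fun x => ‖x - m‖) (by fun_prop)
  have hqmax' : ∀ x ∈ K, ‖x - m‖ ≤ ‖q - m‖ := fun x hx => hqmax hx
  have hpd : ‖p - m‖ = ℓ / 2 := by simpa using hon 0 (by simpa using hp)
  have hqR := hqmax' p (hB.mem_of_frontier hp)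
  rw [hpd] at hqR
  have far : ∀ q : E3, q ∈ K → (∀ x ∈ K, ‖x - m‖ ≤ ‖q - m‖) → ℓ / 2 ≤ ‖q - m‖ →
      q ∈ frontier K ∧ q = m + ‖q - m‖ • η q := fun q hq h h' =>
    hB.normal_of_farthest hq (by rintro rfl; simp at h'; linarith) h
  rcases hqR.lt_or_eq with hlt | heq
  · obtain ⟨h1, h2⟩ := far q hqK hqmax' hqR
    refine ⟨m, q, _, _, hmi, hpm, h1, h2, ?_⟩
    rintro s rfl
    have := hon s h1
    linarith
  · obtain ⟨e, he, hee, -⟩ := exists_orthogonal_pair (η p) 0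
    obtain ⟨t, ht, htf⟩ := hB.exits hmi he
    have hline : ∀ s : ℝ, m + t • e ≠ p + s • η p := by
      intro s h
      have h1 : ⟪t • e, t • e⟫ = 0 := by
        have : t • e = (s + ℓ / 2) • η p := by
          have h3 : t • e = p + s • η p - m := by rw [← h]; abel
          rw [h3, hm]; module
        nth_rewrite 1 [this]
        rw [inner_smul_right, real_inner_smul_left, hee]; ring
      rcases smul_eq_zero.1 (inner_self_eq_zero.1 h1) with h | h
      · linarith
      · exact he h
    have hq0 := hqmax' _ (hB.mem_of_frontier htf)
    rw [← heq] at hq0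
    rcases hq0.lt_or_eq with hlt | heq'
    · have hfc : IsCompact (frontier K) :=
        hB.compact.of_isClosed_subset isClosed_frontier hB.closed.frontier_subset
      obtain ⟨q', hq'f, hq'⟩ := hfc.exists_isMinOn ⟨p, hp⟩
        (f := fun x => ‖x - m‖) (by fun_prop)
      have hq'' : ∀ x ∈ frontier K, ‖q' - m‖ ≤ ‖x - m‖ := fun x hx => hq' hx
      refine ⟨m, q', _, _, hmi, hpm, hq'f, hB.normal_of_nearest hmi hq'f hq'', ?_⟩
      rintro s rfl
      have h1 := hon s hq'f
      have h2 := hq'' _ htf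
      linarith
    · obtain ⟨h1, h2⟩ := far _ (hB.mem_of_frontier htf)
        (by rw [heq', heq]; exact hqmax') heq'.ge
      exact ⟨m, _, _, _, hmi, hpm, h1, h2, hline⟩

/-- Every boundary point admits an elliptic section transversal to its normal line, through an
interior point of that line. -/
theorem exists_transversal (hB : NormalBody K η) (hν : EllField K η ν κ) {p : E3}
    (hp : p ∈ frontier K) : ∃ (g m : E3) (τ : ℝ), ‖g‖ = 1 ∧ ⟪g, η p⟫ ≠ 0 ∧ m ∈ interior K ∧
      p = m + τ • η p ∧ IsEllipse (frontier K ∩ pl (thru m g)) := by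
  obtain ⟨m, q, τ, σ, hm, hpm, hq, hqm, hline⟩ := hB.exists_other_normal hp
  have hex : ∃ i, ⟪ν i q, η p⟫ ≠ 0 := by
    by_contra! hc
    have hn := hν.ne hq
    have := eq_smul_of_orthogonal (hn.unit 0) (hn.unit 1) hn.ne hn.ne' (hB.norm_normal hp) (hc 0)
      (hc 1) (hn.orth 0) (hn.orth 1)
    apply hline (-τ + σ * ⟪η p, η q⟫)
    have e : p + (-τ + σ * ⟪η p, η q⟫) • η p = m + σ • (⟪η p, η q⟫ • η p) := by
      nth_rewrite 1 [hpm]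
      module
    rw [e, ← this]
    exact hqm
  obtain ⟨i, hi⟩ := hex
  refine ⟨ν i q, m, τ, hν.unit q hq i, hi, hm, hpm, ?_⟩
  have : thru m (ν i q) = thru q (ν i q) := by
    refine thru_eq_of_mem ?_
    have h0 : ⟪ν i q, q⟫ = ⟪ν i q, m + σ • η q⟫ := congrArg (fun x => ⟪ν i q, x⟫) hqm
    rw [inner_add_right, inner_smul_right, hν.orth q hq i] at h0
    rw [mem_thru]
    linarith
  rw [this]
  exact hν.ell q hq i

end NormalBody

/-- The function is given by a quadratic polynomial. -/
def IsQuad (f : E3 → ℝ) : Prop := ∃ F : QF, ∀ x, F.ev x = f x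

namespace IsQuad

theorem of_ev (F : QF) : IsQuad F.ev := ⟨F, fun _ => rfl⟩

theorem const (c : ℝ) : IsQuad fun _ => c := ⟨⟨0, 0, c⟩, fun x => by simp [QF.ev]⟩

theorem add {f g : E3 → ℝ} (hf : IsQuad f) (hg : IsQuad g) : IsQuad fun x => f x + g x := by
  obtain ⟨F, hF⟩ := hf
  obtain ⟨G, hG⟩ := hg
  refine ⟨⟨F.B + G.B, F.l + G.l, F.c + G.c⟩, fun x => ?_⟩
  beta_reduce
  rw [← hF, ← hG]
  simp only [QF.ev, add_apply]
  ring

theorem smul {f : E3 → ℝ} (hf : IsQuad f) (a : ℝ) : IsQuad fun x => a * f x := by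
  obtain ⟨F, hF⟩ := hf
  refine ⟨⟨a • F.B, a • F.l, a * F.c⟩, fun x => ?_⟩
  beta_reduce
  rw [← hF]
  simp only [QF.ev, smul_apply, smul_eq_mul]
  ring

theorem comp {f : E3 → ℝ} (hf : IsQuad f) (o : E3) (L : E3 →L[ℝ] E3) :
    IsQuad fun x => f (o + L x) := by
  obtain ⟨F, hF⟩ := hf
  refine ⟨⟨(F.B.comp L).flip.comp L |>.flip, (F.B o + F.B.flip o + F.l).comp L, F.ev o⟩,
    fun x => ?_⟩
  beta_reduce
  rw [← hF]
  simp only [QF.ev, ContinuousLinearMap.flip_apply, ContinuousLinearMap.comp_apply, add_apply,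
    map_add]
  ring

end IsQuad

theorem isQuad_circle : IsQuad fun x => x 0 ^ 2 + x 1 ^ 2 - 1 := by
  refine ⟨⟨(EuclideanSpace.proj 0 : E3 →L[ℝ] ℝ).smulRight (EuclideanSpace.proj 0 : E3 →L[ℝ] ℝ) +
    (EuclideanSpace.proj 1 : E3 →L[ℝ] ℝ).smulRight (EuclideanSpace.proj 1 : E3 →L[ℝ] ℝ), 0, -1⟩,
    fun x => ?_⟩
  simp [QF.ev]
  ring

namespace NormalBody

variable {K : Set E3} {η : E3 → E3} {ν : Fin 2 → E3 → E3} {κ : ℝ}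

theorem exists_quadratic_section (hB : NormalBody K η) {z : E3 × ℝ}
    (hE : IsEllipse (frontier K ∩ pl z)) {m : E3} (hm : m ∈ interior K) (hmz : m ∈ pl z) :
    ∃ F : QF, QP K F z ∧ F.ev m = -1 := by
  obtain ⟨φ, hφ⟩ := hE
  have hin : ∀ y, y ∈ frontier K → y ∈ pl z → φ.symm y ∈ unitCircle3 := by
    intro y h1 h2
    have : y ∈ φ '' unitCircle3 := hφ ▸ ⟨h1, h2⟩
    obtain ⟨x, hx, rfl⟩ := this
    simpa using hx
  have hdec : ∀ y, φ.symm y = φ.symm 0 + φ.symm.linear y := by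
    intro y
    have := φ.symm.map_vadd 0 y
    rw [vadd_eq_add, add_zero, vadd_eq_add] at this
    rw [this, add_comm]
  obtain ⟨F, hF⟩ := isQuad_circle.comp (φ.symm 0)
    (LinearMap.toContinuousLinearMap φ.symm.linear.toLinearMap)
  have hF' : ∀ y, F.ev y = (φ.symm y) 0 ^ 2 + (φ.symm y) 1 ^ 2 - 1 := by
    intro y
    rw [hF, hdec y]
    rfl
  have h2 : (φ.symm m) 2 = 0 := by
    obtain ⟨e, he, hez, -⟩ := exists_orthogonal_pair z.1 0
    obtain ⟨t, ht, htf⟩ := hB.exits hm he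
    obtain ⟨s, hs, hsf⟩ := hB.exits hm (neg_ne_zero.2 he)
    have m1 := (hin _ htf (by
      rw [mem_pl, inner_add_right, inner_smul_right, hez, mem_pl.1 hmz]; ring)).2
    have m2 := (hin _ hsf (by
      rw [mem_pl, inner_add_right, inner_smul_right, inner_neg_right, hez, mem_pl.1 hmz]; ring)).2
    rw [hdec] at m1 m2 ⊢
    simp only [map_add, map_smul, map_neg, PiLp.add_apply, PiLp.smul_apply, PiLp.neg_apply,
      smul_eq_mul] at m1 m2 ⊢
    have : (t + s) * (φ.symm.linear e) 2 = 0 := by linarith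
    have := (mul_eq_zero.1 this).resolve_left (by linarith)
    rw [this] at m1
    linarith
  have hne : F.ev m ≠ 0 := by
    intro h0
    rw [hF'] at h0
    have : φ.symm m ∈ unitCircle3 := ⟨by linarith, h2⟩
    have : m ∈ frontier K ∩ pl z := by
      rw [hφ]
      exact ⟨_, this, by simp⟩
    exact this.1.2 hm
  obtain ⟨G, hG⟩ := (IsQuad.of_ev F).smul (-(F.ev m)⁻¹)
  refine ⟨G, ?_, ?_⟩
  · intro y h1 h3
    have := (hin y h1 h3).1
    have h4 : F.ev y = 0 := by rw [hF', this]; ring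
    rw [hG]
    beta_reduce
    rw [h4, mul_zero]
  · rw [hG]
    field_simp

/-- Two quadratics agree on a line through an interior point if they vanish at its endpoints and
agree at that point. -/
theorem ev_eq_on_line (hB : NormalBody K η) {F G : QF} {z w : E3 × ℝ} (hF : QP K F z)
    (hG : QP K G w) {m : E3} (hm : m ∈ interior K) (hmz : m ∈ pl z) (hmw : m ∈ pl w)
    (hFm : F.ev m = -1) (hGm : G.ev m = -1) {e : E3} (hez : ⟪z.1, e⟫ = 0) (hew : ⟪w.1, e⟫ = 0)
    (r : ℝ) : F.ev (m + r • e) = G.ev (m + r • e) := by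
  by_cases he : e = 0
  · rw [he, smul_zero, add_zero, hFm, hGm]
  obtain ⟨t, ht, htf⟩ := hB.exits hm he
  obtain ⟨s, hs, hsf⟩ := hB.exits hm (neg_ne_zero.2 he)
  rw [smul_neg, ← neg_smul] at hsf
  have hmem : ∀ {z : E3 × ℝ} (r : ℝ), m ∈ pl z → ⟪z.1, e⟫ = 0 → m + r • e ∈ pl z := by
    intro z r h1 h2
    rw [mem_pl, inner_add_right, inner_smul_right, h2, mem_pl.1 h1]; ring
  have f1 := hF _ htf (hmem _ hmz hez)
  have f2 := hF _ hsf (hmem _ hmz hez)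
  have g1 := hG _ htf (hmem _ hmw hew)
  have g2 := hG _ hsf (hmem _ hmw hew)
  rw [QF.ev_add_smul] at f1 f2 g1 g2
  rw [QF.ev_add_smul, QF.ev_add_smul, hFm, hGm]
  rw [hFm] at f1 f2
  rw [hGm] at g1 g2
  generalize F.D m e = a at *
  generalize F.B e e = b at *
  generalize G.D m e = c at *
  generalize G.B e e = d at *
  have hts : t + s ≠ 0 := by linarith
  have k1 : t * ((a - c) + t * (b - d)) = 0 := by linear_combination f1 - g1
  have k2 : s * (-(a - c) + s * (b - d)) = 0 := by linear_combination f2 - g2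
  have k1' := (mul_eq_zero.1 k1).resolve_left ht.ne'
  have k2' := (mul_eq_zero.1 k2).resolve_left hs.ne'
  have k3 : (t + s) * (b - d) = 0 := by linarith
  have k4 := (mul_eq_zero.1 k3).resolve_left hts
  rw [k4] at k1'
  have : a = c := by linarith
  have : b = d := by linarith
  subst_vars
  rfl

/-- There is a quadratic through three elliptic sections in general position sharing an interior
point. -/
theorem exists_quadratic_three (hB : NormalBody K η) {m a b c : E3} (hm : m ∈ interior K)
    (hT : Trip a b c) (ha : IsEllipse (frontier K ∩ pl (thru m a)))
    (hb : IsEllipse (frontier K ∩ pl (thru m b))) (hc : IsEllipse (frontier K ∩ pl (thru m c))) :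
    ∃ F : QF, QP K F (thru m a) ∧ QP K F (thru m b) ∧ QP K F (thru m c) ∧ F.ev m ≠ 0 := by
  obtain ⟨A, hA, hAm⟩ := hB.exists_quadratic_section ha hm (self_mem_thru m a)
  obtain ⟨B, hBq, hBm⟩ := hB.exists_quadratic_section hb hm (self_mem_thru m b)
  obtain ⟨C, hC, hCm⟩ := hB.exists_quadratic_section hc hm (self_mem_thru m c)
  obtain ⟨u, ua, ub, uc⟩ := hT.exists_dual
  obtain ⟨v, vb, vc, va⟩ := hT.rotate.exists_dual
  obtain ⟨w, wc, wa, wb⟩ := hT.rotate.rotate.exists_dual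
  have hdec : ∀ x, x = ⟪a, x⟫ • u + ⟪b, x⟫ • v + ⟪c, x⟫ • w := by
    intro x
    rw [← sub_eq_zero]
    refine hT _ ?_ ?_ ?_ <;> rw [inner_sub_right, inner_add_right, inner_add_right,
      inner_smul_right, inner_smul_right, inner_smul_right]
    · rw [ua, va, wa]; ring
    · rw [ub, vb, wb]; ring
    · rw [uc, vc, wc]; ring
  set pu : E3 →L[ℝ] E3 := (innerSL ℝ a).smulRight u with hpu
  set pv : E3 →L[ℝ] E3 := (innerSL ℝ b).smulRight v with hpv
  set pw : E3 →L[ℝ] E3 := (innerSL ℝ c).smulRight w with hpw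
  have hpu' : ∀ x, pu x = ⟪a, x⟫ • u := fun x => rfl
  have hpv' : ∀ x, pv x = ⟪b, x⟫ • v := fun x => rfl
  have hpw' : ∀ x, pw x = ⟪c, x⟫ • w := fun x => rfl
  have hcomp : ∀ {f : E3 → ℝ}, IsQuad f → ∀ L : E3 →L[ℝ] E3, IsQuad fun x => f (m + L (x - m)) := by
    intro f hf L
    have := hf.comp (m - L m) L
    convert this using 2 with x
    rw [map_sub]
    congr 1
    abel
  obtain ⟨F, hF⟩ := (((((hcomp (IsQuad.of_ev A) (pv + pw)).add
    (hcomp (IsQuad.of_ev B) (pu + pw))).add (hcomp (IsQuad.of_ev C) (pu + pv))).add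
    ((hcomp (IsQuad.of_ev B) pu).smul (-1))).add ((hcomp (IsQuad.of_ev C) pv).smul (-1))).add
    (((hcomp (IsQuad.of_ev A) pw).smul (-1)).add (IsQuad.const (-1)))
  have hF' : ∀ x, F.ev (m + x) = A.ev (m + (⟪b, x⟫ • v + ⟪c, x⟫ • w)) +
      B.ev (m + (⟪a, x⟫ • u + ⟪c, x⟫ • w)) + C.ev (m + (⟪a, x⟫ • u + ⟪b, x⟫ • v)) -
      B.ev (m + ⟪a, x⟫ • u) - C.ev (m + ⟪b, x⟫ • v) - A.ev (m + ⟪c, x⟫ • w) - 1 := by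
    intro x
    rw [hF]
    simp only [add_apply, add_sub_cancel_left, hpu', hpv', hpw']
    ring
  have hx : ∀ {n y : E3}, y ∈ pl (thru m n) → ⟪n, y - m⟫ = 0 := by
    intro n y h
    rw [mem_thru] at h
    rw [inner_sub_right, h, sub_self]
  have hBC := hB.ev_eq_on_line hBq hC hm (self_mem_thru m b) (self_mem_thru m c) hBm hCm
    (e := u) ub uc
  have hAC := hB.ev_eq_on_line hC hA hm (self_mem_thru m c) (self_mem_thru m a) hCm hAm
    (e := v) vc va
  have hAB := hB.ev_eq_on_line hA hBq hm (self_mem_thru m a) (self_mem_thru m b) hAm hBm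
    (e := w) wa wb
  refine ⟨F, ?_, ?_, ?_, ?_⟩
  · intro y hy hyz
    have h0 := hx hyz
    have h1 := hdec (y - m)
    have h2 := hF' (y - m)
    have h3 := hA y hy hyz
    rw [h0, zero_smul, zero_add] at h1
    rw [h0, zero_smul, zero_add, zero_add, ← h1, add_zero, add_sub_cancel, h3, hBm, hAB] at h2
    linarith
  · intro y hy hyz
    have h0 := hx hyz
    have h1 := hdec (y - m)
    have h2 := hF' (y - m)
    have h3 := hBq y hy hyz
    rw [h0, zero_smul, add_zero] at h1
    rw [h0, zero_smul, add_zero, zero_add, add_zero, ← h1, add_sub_cancel, h3, hCm, hBC] at h2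
    linarith
  · intro y hy hyz
    have h0 := hx hyz
    have h1 := hdec (y - m)
    have h2 := hF' (y - m)
    have h3 := hC y hy hyz
    rw [h0, zero_smul, add_zero] at h1
    rw [h0, zero_smul, add_zero, add_zero, add_zero, ← h1, add_sub_cancel, h3, hAm, hAC] at h2
    linarith
  · have := hF' 0
    simp only [inner_zero_right, zero_smul, add_zero] at this
    rw [this, hAm, hBm, hCm]
    norm_num

end NormalBody

theorem exists_angle {s t : ℝ} (h : s ^ 2 + t ^ 2 = 1) :
    ∃ θ : ℝ, s = Real.cos θ ∧ t = Real.sin θ := by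
  have hn : ‖(⟨s, t⟩ : ℂ)‖ = 1 := by
    rw [Complex.norm_def, Complex.normSq_mk, ← sq, ← sq, h, Real.sqrt_one]
  have h0 : (⟨s, t⟩ : ℂ) ≠ 0 := by
    rw [← norm_ne_zero_iff, hn]; norm_num
  exact ⟨Complex.arg ⟨s, t⟩, by rw [Complex.cos_arg h0, hn, div_one],
    by rw [Complex.sin_arg, hn, div_one]⟩

theorem IsEllipse.exists_angle_param {E : Set E3} (hE : IsEllipse E) :
    ∃ o u v : E3, (∀ s t : ℝ, s • u + t • v = 0 → s = 0 ∧ t = 0) ∧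
      ∀ y, y ∈ E ↔ ∃ θ : ℝ, y = o + Real.cos θ • u + Real.sin θ • v := by
  obtain ⟨o, u, v, hli, h⟩ := hE.exists_param
  refine ⟨o, u, v, hli, fun y => (h y).trans ⟨?_, ?_⟩⟩
  · rintro ⟨s, t, hst, rfl⟩
    obtain ⟨θ, rfl, rfl⟩ := exists_angle hst
    exact ⟨θ, rfl⟩
  · rintro ⟨θ, rfl⟩
    exact ⟨_, _, Real.cos_sq_add_sin_sq θ, rfl⟩

theorem tendsto_param {S : Set E3} {o u v : E3}
    (h : ∀ θ : ℝ, o + Real.cos θ • u + Real.sin θ • v ∈ S) (θ : ℝ) :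
    Tendsto (fun θ : ℝ => o + Real.cos θ • u + Real.sin θ • v) (𝓝 θ)
      (𝓝[S] (o + Real.cos θ • u + Real.sin θ • v)) := by
  refine tendsto_nhdsWithin_iff.2 ⟨?_, Eventually.of_forall h⟩
  have : Continuous fun θ : ℝ => o + Real.cos θ • u + Real.sin θ • v := by fun_prop
  exact this.tendsto θ

theorem Om.QP {K : Set E3} {F : QF} {x : E3} (hx : Om K F x) {z : E3 × ℝ}
    (hE : IsEllipse (frontier K ∩ pl z)) (hxf : x ∈ frontier K) (hxz : x ∈ pl z) : QP K F z := by
  obtain ⟨o, u, v, -, h⟩ := hE.exists_angle_param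
  obtain ⟨θ₀, hθ₀⟩ := (h x).1 ⟨hxf, hxz⟩
  have hmem : ∀ θ : ℝ, o + Real.cos θ • u + Real.sin θ • v ∈ frontier K ∩ pl z :=
    fun θ => (h _).2 ⟨θ, rfl⟩
  have han : AnalyticOnNhd ℝ (fun θ : ℝ => F.ev (o + Real.cos θ • u + Real.sin θ • v)) univ := by
    intro θ _
    simp only [QF.ev_param]
    fun_prop
  have hzero : (fun θ : ℝ => F.ev (o + Real.cos θ • u + Real.sin θ • v)) =ᶠ[𝓝 θ₀] 0 := by
    have := tendsto_param (fun θ => (hmem θ).1) θ₀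
    rw [← hθ₀] at this
    exact this.eventually hx
  have := han.eqOn_zero_of_preconnected_of_eventuallyEq_zero isPreconnected_univ (mem_univ θ₀) hzero
  intro y hy hyz
  obtain ⟨θ, rfl⟩ := (h y).1 ⟨hy, hyz⟩
  exact this (mem_univ θ)

namespace NormalBody

variable {K : Set E3} {η : E3 → E3} {ν : Fin 2 → E3 → E3} {κ : ℝ}

/-- Vanishing on sections passes to limits of sections. -/
theorem QP_of_limit (hB : NormalBody K η) {F : QF} {z : E3 × ℝ}
    (hm : (pl z ∩ interior K).Nonempty)
    (h : ∃ᶠ w in 𝓝 z, ‖w.1‖ = 1 ∧ QP K F w) : QP K F z := by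
  intro y hy hyz
  by_contra hne
  obtain ⟨m, hmz, hmi⟩ := hm
  have hW : {x | F.ev x ≠ 0} ∈ 𝓝 y := F.continuous_ev.continuousAt.eventually_ne hne
  obtain ⟨ε, hε, hεW⟩ := Metric.mem_nhds_iff.1 hW
  have hηm : ⟪η y, y - m⟫ > 0 := by
    have := hB.normal_lt hy hmi
    rw [inner_sub_right]; linarith
  obtain ⟨t, ht, hti⟩ := hB.inward hy (u := m - y)
    (by rw [← neg_sub, inner_neg_right]; linarith)
  have hsm : ∀ᶠ s in 𝓝[>] (0 : ℝ), y + s • (m - y) ∈ Metric.ball y ε ∧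
      y + s • (y - m) ∈ Metric.ball y ε ∧ s ≤ t := by
    have hc : ∀ e : E3, ∀ᶠ s in 𝓝[>] (0 : ℝ), y + s • e ∈ Metric.ball y ε := by
      intro e
      have : Continuous (fun t : ℝ => y + t • e) := by fun_prop
      have h := this.tendsto 0
      simp only [zero_smul, add_zero] at h
      exact (h.mono_left nhdsWithin_le_nhds) (Metric.ball_mem_nhds y hε)
    refine (hc _).and ((hc _).and ?_)
    exact nhdsWithin_le_nhds ((eventually_lt_nhds ht).mono fun _ h => h.le)
  obtain ⟨s, ⟨hs1, hs2, hst⟩, hs0⟩ := (hsm.and self_mem_nhdsWithin).exists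
  have hs0 : (0 : ℝ) < s := hs0
  set a := y + s • (m - y) with ha
  set b := y + s • (y - m) with hb
  have hai : a ∈ interior K := hti s hs0 hst
  have hbK : b ∉ K := hB.outside hy hηm hs0
  set π : E3 × ℝ → E3 → E3 := fun w x => x - (⟪w.1, x⟫ - w.2) • w.1 with hπ
  have hπz : ∀ x, x ∈ pl z → π z x = x := by
    intro x hx
    simp [hπ, mem_pl.1 hx]
  rw [mem_pl] at hyz hmz
  have haz : a ∈ pl z := by
    rw [mem_pl, ha, inner_add_right, inner_smul_right, inner_sub_right, hyz, hmz]; ring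
  have hbz : b ∈ pl z := by
    rw [mem_pl, hb, inner_add_right, inner_smul_right, inner_sub_right, hyz, hmz]; ring
  have hpc : ∀ x, Continuous fun w => π w x := fun x => by fun_prop
  have hev : ∀ x, x ∈ pl z → ∀ {O : Set E3}, IsOpen O → x ∈ O → ∀ᶠ w in 𝓝 z, π w x ∈ O := by
    intro x hx O hO hxO
    exact (hpc x).continuousAt.eventually (hO.mem_nhds (by beta_reduce; rwa [hπz x hx]))
  have e1 := hev a haz isOpen_interior hai
  have e2 := hev b hbz hB.closed.isOpen_compl hbK
  have e3 := hev a haz Metric.isOpen_ball hs1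
  have e4 := hev b hbz Metric.isOpen_ball hs2
  obtain ⟨w, ⟨hw1, hw⟩, w1, w2, w3, w4⟩ := (h.and_eventually (e1.and (e2.and (e3.and e4)))).exists
  have hπw : ∀ x, π w x ∈ pl w := by
    intro x
    rw [mem_pl, hπ, inner_sub_right, inner_smul_right, real_inner_self_eq_norm_sq, hw1]
    ring
  obtain ⟨x, hx, hxf⟩ := exists_frontier_of_preconnected
    (convex_segment (𝕜 := ℝ) (π w a) (π w b)).isPreconnected
    ⟨_, left_mem_segment _ _ _, w1⟩ ⟨_, right_mem_segment _ _ _, w2⟩ hB.closed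
  exact hεW ((convex_ball y ε).segment_subset w3 w4 hx)
    (hw x hxf ((convex_pl w).segment_subset (hπw a) (hπw b) hx))

/-- The set where a quadratic locally vanishes is closed in the boundary. -/
theorem om_of_frequently (hB : NormalBody K η) (hν : EllField K η ν κ) {F : QF} {p : E3}
    (hp : p ∈ frontier K) (h : ∃ᶠ x in 𝓝[frontier K] p, Om K F x) : Om K F p := by
  by_contra hno
  have hne := Filter.frequently_iff_neBot.1 h
  obtain ⟨U, hUle⟩ : ∃ U : Ultrafilter E3, (U : Filter E3) ≤
      𝓝[frontier K] p ⊓ 𝓟 {x | Om K F x} := ⟨_, Ultrafilter.of_le _⟩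
  have hU := hUle.trans inf_le_left
  have hUf : ∀ᶠ x in (U : Filter E3), x ∈ frontier K := hU self_mem_nhdsWithin
  have hUO : ∀ᶠ x in (U : Filter E3), Om K F x := (hUle.trans inf_le_right) (mem_principal_self _)
  obtain ⟨N, hN, hNt⟩ := hB.exists_limit hν hp hU
  obtain ⟨ℓ, hℓ, hfℓ, hiℓ⟩ := hB.exists_normal_chord hp
  obtain ⟨g, m, τ, hg, hgη, hm, hτ, hGell⟩ := hB.exists_transversal hν hp
  have hUb : ∀ᶠ x in (U : Filter E3), x ∈ Metric.ball p ℓ :=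
    (hU.trans nhdsWithin_le_nhds) (Metric.ball_mem_nhds p hℓ)
  have qx : ∀ᶠ x in (U : Filter E3), ∀ i, QP K F (thru x (ν i x)) := by
    filter_upwards [hUf, hUO] with x hx hxO i
    exact hxO.QP (hν.ell x hx i) hx (self_mem_thru x _)
  have F0 : Frame K η ⟨0, 0, 0⟩ p N g m τ :=
    ⟨hp, hN, hg, hgη, hm, hτ, fun i y _ _ => by simp [QF.ev], fun y _ _ => by simp [QF.ev]⟩
  have qN : ∀ i, QP K F (thru p (N i)) := by
    intro i
    refine hB.QP_of_limit ⟨m, F0.m_mem (hN.orth i), hm⟩ ?_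
    refine (hNt i).frequently (Eventually.frequently ?_)
    filter_upwards [hUf, qx] with x hx hxq
    exact ⟨hν.unit x hx i, hxq i⟩
  have e1 : ∀ᶠ x in (U : Filter E3), ∀ i j, i ≠ j → (ν i x ≠ N j ∧ ν i x ≠ -N j) ∧
      (pl (thru x (ν i x)) ∩ pl (thru p (N j)) ∩ interior K).Nonempty := by
    rw [eventually_all]; intro i
    rw [eventually_all]; intro j
    by_cases hij : i = j
    · exact Eventually.of_forall fun x h => absurd hij h
    · have hh := Frame.ne_pair hN hij
      have e2 := (hNt i).eventually (NormalBody.eventually_meet (K := K) (A := thru p (N j))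
        (hN.unit i) (hN.unit j) hh.1 hh.2
        ⟨m, ⟨F0.m_mem (hN.orth i), F0.m_mem (hN.orth j)⟩, hm⟩)
      have e3 := (hNt i).eventually (eventually_fst_ne (N := thru p (N i)) hh.1 hh.2)
      filter_upwards [e2, e3] with x h2 h3 _
      exact ⟨h3, h2⟩
  have e2 : ∀ᶠ x in (U : Filter E3), ∀ i, (ν i x ≠ g ∧ ν i x ≠ -g) ∧
      (pl (thru x (ν i x)) ∩ pl (thru m g) ∩ interior K).Nonempty := by
    rw [eventually_all]; intro i
    have hh := F0.ne_g (hN.orth i)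
    have e2 := (hNt i).eventually (NormalBody.eventually_meet (K := K) (A := thru m g)
      (hN.unit i) hg hh.1 hh.2 ⟨m, ⟨F0.m_mem (hN.orth i), self_mem_thru m g⟩, hm⟩)
    have e3 := (hNt i).eventually (eventually_fst_ne (N := thru p (N i)) hh.1 hh.2)
    filter_upwards [e2, e3] with x h2 h3
    exact ⟨h3, h2⟩
  obtain ⟨x, ⟨⟨⟨⟨⟨hx, hxO⟩, hxb⟩, hxq⟩, x1⟩, x2⟩⟩ :=
    (((((hUf.and hUO).and hUb).and qx).and e1).and e2).exists
  obtain ⟨i, hi⟩ : ∃ i, pl (thru x (ν i x)) ≠ pl (thru p (N i)) := by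
    by_contra! hc
    have hxN : ∀ i, ⟪N i, x - p⟫ = 0 := by
      intro i
      have : x ∈ pl (thru p (N i)) := hc i ▸ self_mem_thru x _
      rw [mem_thru] at this
      rw [inner_sub_right, this, sub_self]
    have hs := eq_smul_of_orthogonal (hN.unit 0) (hN.unit 1) hN.ne hN.ne' (hB.norm_normal hp)
      (hN.orth 0) (hN.orth 1) (hxN 0) (hxN 1)
    have hxp : x = p + ⟪η p, x - p⟫ • η p := by rw [← hs]; abel
    rcases hB.line_frontier hp hℓ hfℓ hiℓ (hxp ▸ hx) with h0 | h0
    · rw [h0, zero_smul, add_zero] at hxp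
      exact hno (hxp ▸ hxO)
    · rw [Metric.mem_ball, dist_eq_norm, hs, norm_smul, hB.norm_normal hp, h0, Real.norm_eq_abs,
        abs_neg, abs_of_pos hℓ] at hxb
      linarith
  obtain ⟨j, hij⟩ : ∃ j : Fin 2, i ≠ j := by
    fin_cases i
    · exact ⟨1, by simp⟩
    · exact ⟨0, by simp⟩
  have hpair := Frame.ne_pair hN hij
  have hgi := F0.ne_g (hN.orth i)
  have hxu := hν.unit x hx i
  have bj : pl (thru x (ν i x)) ≠ pl (thru p (N j)) :=
    pl_ne_of_ne hxu (hN.unit j) (x1 i j hij).1.1 (x1 i j hij).1.2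
  have bg : pl (thru x (ν i x)) ≠ pl (thru m g) := pl_ne_of_ne hxu hg (x2 i).1.1 (x2 i).1.2
  have qg : QP K F (thru m g) := by
    refine hB.QP_of_three_meet (A := thru p (N i)) (C := thru p (N j)) (B := thru x (ν i x)) hGell
      (qN i) (qN j) (hxq i) (hN.unit i) hxu (hN.unit j)
      ⟨m, ⟨self_mem_thru m g, F0.m_mem (hN.orth i)⟩, hm⟩
      ⟨m, ⟨self_mem_thru m g, F0.m_mem (hN.orth j)⟩, hm⟩ ?_ hi bj (x1 i j hij).2 (x2 i).2
    have := F0.disjoint (hN.unit i) (hN.orth i) (hB.norm_normal hp) hpair.1 hpair.2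
    rw [← this]
    ext y
    simp only [mem_inter_iff]
    tauto
  have FF : Frame K η F p N g m τ := ⟨hp, hN, hg, hgη, hm, hτ, qN, qg⟩
  exact hno (FF.om_of_third hB hν hij (B := thru x (ν i x)) hxu (hxq i) hi bg (x2 i).2
    (x1 i j hij).2 (x1 i j hij).1.1 (x1 i j hij).1.2)

/-- Either some nondegenerate quadratic locally describes the boundary, or every elliptic normal
section is flat, i.e. the normals along it stay in its plane. -/
theorem om_or_all_flat (hB : NormalBody K η) (hν : EllField K η ν κ) {p : E3}
    (hp : p ∈ frontier K) (hno : ∀ (F : QF) (m : E3), m ∈ interior K → F.ev m ≠ 0 → ¬ Om K F p)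
    {n : E3} (hn : ‖n‖ = 1) (hnη : ⟪n, η p⟫ = 0) (hE : IsEllipse (frontier K ∩ pl (thru p n))) :
    ∀ᶠ x in 𝓝[frontier K ∩ pl (thru p n)] p, ⟪n, η x⟫ = 0 := by
  obtain ⟨k, k1, k2⟩ := (hν.ne hp).pick n
  obtain ⟨g, m, τ, hg, hgη, hm, hτ, hGell⟩ := hB.exists_transversal hν hp
  have hku := hν.unit p hp k
  have hko := hν.orth p hp k
  have hpair : NPair η p ![n, ν k p] := by
    refine ⟨?_, ?_, ?_, ?_⟩
    · intro i; fin_cases i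
      · exact hn
      · exact hku
    · intro i; fin_cases i
      · exact hnη
      · exact hko
    · exact k1.symm
    · intro h
      exact k2 (by simpa using (neg_eq_iff_eq_neg.2 h).symm)
  have hmem : ∀ {N : E3}, ⟪N, η p⟫ = 0 → thru m N = thru p N := by
    intro N hN
    refine thru_eq_of_mem ?_
    have h0 : ⟪N, p⟫ = ⟪N, m + τ • η p⟫ := congrArg (fun x => ⟪N, x⟫) hτ
    rw [inner_add_right, inner_smul_right, hN] at h0
    rw [mem_thru]
    linarith
  obtain ⟨F, q1, q2, q3, hFm⟩ := hB.exists_quadratic_three hm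
    (trip_of_ne hn hku k1.symm (hpair.ne') hnη hko hgη)
    (by rwa [hmem hnη]) (by rw [hmem hko]; exact hν.ell p hp k) hGell
  rw [hmem hnη] at q1
  rw [hmem hko] at q2
  have FF : Frame K η F p ![n, ν k p] g m τ := by
    refine ⟨hp, hpair, hg, hgη, hm, hτ, ?_, q3⟩
    intro i; fin_cases i
    · exact q1
    · exact q2
  exact (FF.om_or_flat hB hν 0).resolve_left (hno F m hm hFm)

end NormalBody

theorem isQuad_sphere (o : E3) (r : ℝ) : IsQuad fun x => ‖x - o‖ ^ 2 - r ^ 2 := by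
  refine ⟨⟨innerSL ℝ, (-2 : ℝ) • innerSL ℝ o, ‖o‖ ^ 2 - r ^ 2⟩, fun x => ?_⟩
  simp only [QF.ev, smul_apply, innerSL_apply_apply, smul_eq_mul]
  have hxx : (innerSL ℝ x : E3 →L[ℝ] ℝ) x = ⟪x, x⟫ := rfl
  erw [hxx]
  rw [norm_sub_sq_real, real_inner_self_eq_norm_sq, real_inner_comm o x]
  ring

/-- Every elliptic normal section is flat near its base point. -/
def AllFlat (K : Set E3) (η : E3 → E3) : Prop :=
  ∀ p ∈ frontier K, ∀ n : E3, ‖n‖ = 1 → ⟪n, η p⟫ = 0 → IsEllipse (frontier K ∩ pl (thru p n)) →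
    ∀ᶠ x in 𝓝[frontier K ∩ pl (thru p n)] p, ⟪n, η x⟫ = 0

namespace NormalBody

variable {K : Set E3} {η : E3 → E3} {ν : Fin 2 → E3 → E3} {κ : ℝ}

theorem flat_of_allFlat (hB : NormalBody K η) (hfl : AllFlat K η) {p n : E3}
    (hp : p ∈ frontier K) (hn : ‖n‖ = 1) (hnp : ⟪n, η p⟫ = 0)
    (hE : IsEllipse (frontier K ∩ pl (thru p n))) :
    ∀ x ∈ frontier K, x ∈ pl (thru p n) → ⟪n, η x⟫ = 0 := by
  obtain ⟨o, u, v, -, h⟩ := hE.exists_angle_param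
  obtain ⟨θ₀, hθ₀⟩ := (h p).1 ⟨hp, self_mem_thru p n⟩
  set γ : ℝ → E3 := fun θ => o + Real.cos θ • u + Real.sin θ • v with hγ
  have hmem : ∀ θ : ℝ, γ θ ∈ frontier K ∩ pl (thru p n) := fun θ => (h _).2 ⟨θ, rfl⟩
  have hc : Continuous fun θ => ⟪n, η (γ θ)⟫ := by
    rw [continuous_iff_continuousAt]
    intro θ
    exact tendsto_const_nhds.inner ((hB.normal_continuousOn (γ θ) (hmem θ).1).tendsto.comp
      (tendsto_param (fun θ => (hmem θ).1) θ))
  have hcl : IsClopen {θ | ⟪n, η (γ θ)⟫ = 0} := by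
    refine ⟨isClosed_eq hc continuous_const, isOpen_iff_mem_nhds.2 fun θ hθ => ?_⟩
    have heq : thru (γ θ) n = thru p n := thru_eq_of_mem (hmem θ).2
    have := hfl (γ θ) (hmem θ).1 n hn hθ (by rwa [heq])
    rw [heq] at this
    exact (tendsto_param hmem θ).eventually this
  have huniv := hcl.eq_univ ⟨θ₀, by
    show ⟪n, η (γ θ₀)⟫ = 0
    have : γ θ₀ = p := hθ₀.symm
    rwa [this]⟩
  intro x hx hxz
  obtain ⟨θ, rfl⟩ := (h x).1 ⟨hx, hxz⟩
  exact (huniv ▸ mem_univ θ : θ ∈ {θ | ⟪n, η (γ θ)⟫ = 0})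

theorem normal_opposite (hB : NormalBody K η) (hν : EllField K η ν κ) (hfl : AllFlat K η) {x : E3}
    (hx : x ∈ frontier K) {ℓ : ℝ} (hℓ : 0 < ℓ) (hf : x + (-ℓ) • η x ∈ frontier K)
    (hi : ∀ s : ℝ, 0 < s → s < ℓ → x + (-s) • η x ∈ interior K) :
    η (x + (-ℓ) • η x) = -η x := by
  have hn := hν.ne hx
  have horth : ∀ i, ⟪ν i x, η (x + (-ℓ) • η x)⟫ = 0 := fun i =>
    hB.flat_of_allFlat hfl hx (hn.unit i) (hn.orth i) (hν.ell x hx i) _ hf (by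
      rw [mem_thru, inner_add_right, inner_smul_right, hν.orth x hx i]; ring)
  have h1 := eq_smul_of_orthogonal (hn.unit 0) (hn.unit 1) hn.ne hn.ne' (hB.norm_normal hx)
    (hn.orth 0) (hn.orth 1) (horth 0) (horth 1)
  have h2 := hB.normal_lt hf (hi (ℓ / 2) (by linarith) (by linarith))
  have h3 := congrArg norm h1
  set y := x + (-ℓ) • η x with hy
  have h4 : x + (-(ℓ / 2)) • η x = y + (ℓ / 2) • η x := by rw [hy]; module
  rw [h4, inner_add_right, inner_smul_right] at h2
  rw [norm_smul, hB.norm_normal hx, hB.norm_normal hf, mul_one, Real.norm_eq_abs] at h3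
  have h5 : ⟪η y, η x⟫ < 0 := by nlinarith
  rw [real_inner_comm, abs_of_neg h5] at h3
  rw [h1, real_inner_comm, show ⟪η y, η x⟫ = -1 by linarith]
  module

theorem sphere_of_allFlat (hB : NormalBody K η) (hν : EllField K η ν κ) (hfl : AllFlat K η)
    {p n : E3} (hp : p ∈ frontier K) (hn : ‖n‖ = 1) (hnp : ⟪n, η p⟫ = 0)
    (hE : IsEllipse (frontier K ∩ pl (thru p n))) {ℓ : E3 → ℝ}
    (hℓ : ∀ x ∈ frontier K, 0 < ℓ x ∧ x + (-ℓ x) • η x ∈ frontier K ∧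
      ∀ s : ℝ, 0 < s → s < ℓ x → x + (-s) • η x ∈ interior K) :
    ∃ (o : E3) (r : ℝ), ∀ x ∈ frontier K, x ∈ pl (thru p n) →
      ℓ x / 2 = r ∧ x + (-(ℓ x / 2)) • η x = o := by
  obtain ⟨o, u, v, -, h⟩ := hE.exists_param
  have key : ∀ s t : ℝ, s ^ 2 + t ^ 2 = 1 →
      s • u + t • v = (ℓ (o + s • u + t • v) / 2) • η (o + s • u + t • v) := by
    intro s t hst
    have hxm := (h (o + s • u + t • v)).2 ⟨s, t, hst, rfl⟩
    have htan := hB.tangent_orthogonal h hst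
    set x := o + s • u + t • v with hx
    obtain ⟨l1, l2, l3⟩ := hℓ x hxm.1
    have hopp := hB.normal_opposite hν hfl hxm.1 l1 l2 l3
    have hfx := hB.flat_of_allFlat hfl hp hn hnp hE x hxm.1 hxm.2
    have hx' : x + (-ℓ x) • η x ∈ pl (thru p n) := by
      have := mem_thru.1 hxm.2
      rw [mem_thru, inner_add_right, inner_smul_right, hfx, this]; ring
    obtain ⟨s', t', hst', hxx⟩ := (h _).1 ⟨l2, hx'⟩
    have htan' := hB.tangent_orthogonal h hst'
    rw [← hxx, hopp] at htan'
    have hxo : ∀ w, ⟪w, x⟫ = ⟪w, o⟫ + s * ⟪w, u⟫ + t * ⟪w, v⟫ := fun w => by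
      rw [hx, inner_add_right, inner_add_right, inner_smul_right, inner_smul_right]
    replace hxo := hxo (η x)
    have hxx' := congrArg (fun y => ⟪η x, y - x⟫) hxx
    simp only [hx] at hxx'
    rw [← hx] at hxx'
    simp only [add_sub_cancel_left, inner_sub_right, inner_add_right, inner_smul_right,
      inner_neg_left, hB.inner_normal_self hxm.1] at hxx' htan htan'
    generalize ⟪η x, u⟫ = a at *
    generalize ⟪η x, v⟫ = b at *
    have ha : a * (s * t' - s' * t) = 0 := by linear_combination s * htan' + s' * htan
    have hb : b * (s * t' - s' * t) = 0 := by linear_combination t * htan' + t' * htan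
    have hdet : s * t' - s' * t = 0 := by
      by_contra hne
      have ha := (mul_eq_zero.1 ha).resolve_right hne
      have hb := (mul_eq_zero.1 hb).resolve_right hne
      rw [ha, hb] at hxx' hxo
      linarith
    have hs' : s' = (s * s' + t * t') * s := by linear_combination (-s') * hst - t * hdet
    have ht' : t' = (s * s' + t * t') * t := by linear_combination (-t') * hst + s * hdet
    have hk : (s * s' + t * t') ^ 2 = 1 := by
      have e : (s * s' + t * t') ^ 2 + (s * t' - s' * t) ^ 2 = (s ^ 2 + t ^ 2) * (s' ^ 2 + t' ^ 2) := by
        ring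
      rw [hdet, hst, hst'] at e
      linarith
    rcases (by simpa using hk : (s * s' + t * t') = 1 ∨ (s * s' + t * t') = -1) with hk | hk
    · exfalso
      rw [hk, one_mul] at hs' ht'
      rw [hs', ht'] at hxx'
      linarith
    · rw [hk] at hs' ht'
      have e2 : ℓ x • η x = (2 : ℝ) • (s • u + t • v) := by
        have : ℓ x • η x = x - (x + (-ℓ x) • η x) := by module
        rw [this, hxx, hs', ht', hx]
        module
      rw [div_eq_inv_mul, mul_smul, e2, smul_smul]
      norm_num
  have hperp : ∀ s t : ℝ, s ^ 2 + t ^ 2 = 1 → ⟪s • u + t • v, -t • u + s • v⟫ = 0 := by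
    intro s t hst
    rw [key s t hst, real_inner_smul_left, hB.tangent_orthogonal h hst, mul_zero]
  have huv : ⟪u, v⟫ = 0 := by simpa using hperp 1 0 (by norm_num)
  have huu : ⟪u, u⟫ = ⟪v, v⟫ := by
    have := hperp (3 / 5) (4 / 5) (by norm_num)
    simp only [inner_add_left, inner_add_right, real_inner_smul_left, inner_smul_right,
      real_inner_comm u v, huv] at this
    linarith
  refine ⟨o, ‖u‖, fun x hx hxz => ?_⟩
  obtain ⟨s, t, hst, rfl⟩ := (h x).1 ⟨hx, hxz⟩
  have hk := key s t hst
  have hpos := (hℓ _ hx).1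
  have hnorm := hB.norm_normal hx
  set x := o + s • u + t • v with hxd
  constructor
  · have h1 : ‖s • u + t • v‖ ^ 2 = ‖u‖ ^ 2 := by
      rw [← real_inner_self_eq_norm_sq, ← real_inner_self_eq_norm_sq]
      simp only [inner_add_left, inner_add_right, real_inner_smul_left, inner_smul_right,
        real_inner_comm u v, huv, ← huu]
      linear_combination ⟪u, u⟫ * hst
    rw [hk, norm_smul, hnorm, mul_one, Real.norm_eq_abs, abs_of_pos (by linarith)] at h1
    exact (pow_left_inj₀ (by linarith) (norm_nonneg _) two_ne_zero).1 h1
  · rw [neg_smul, ← hk, hxd]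
    abel

/-- If every elliptic normal section is flat, the boundary is locally a sphere. -/
theorem om_of_allFlat (hB : NormalBody K η) (hν : EllField K η ν κ) (hfl : AllFlat K η) {p : E3}
    (hp : p ∈ frontier K) : ∃ (F : QF) (m : E3), m ∈ interior K ∧ F.ev m ≠ 0 ∧ Om K F p := by
  have hex : ∀ x, ∃ l : ℝ, x ∈ frontier K → 0 < l ∧ x + (-l) • η x ∈ frontier K ∧
      ∀ s : ℝ, 0 < s → s < l → x + (-s) • η x ∈ interior K := by
    intro x
    by_cases hx : x ∈ frontier K
    · obtain ⟨l, h⟩ := hB.exists_normal_chord hx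
      exact ⟨l, fun _ => h⟩
    · exact ⟨0, fun h => absurd h hx⟩
  choose ℓ hℓ using hex
  set c : E3 → E3 := fun x => x + (-(ℓ x / 2)) • η x with hc
  have hcm : c p ∈ interior K := (hℓ p hp).2.2 _ (by linarith [(hℓ p hp).1]) (by linarith [(hℓ p hp).1])
  have hrad : ∀ x ∈ frontier K, ‖x - c x‖ = ℓ x / 2 := by
    intro x hx
    have : x - c x = (ℓ x / 2) • η x := by rw [hc]; module
    rw [this, norm_smul, hB.norm_normal hx, mul_one, Real.norm_eq_abs,
      abs_of_pos (by linarith [(hℓ x hx).1])]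
  obtain ⟨F, hF⟩ := isQuad_sphere (c p) (ℓ p / 2)
  refine ⟨F, c p, hcm, ?_, ?_⟩
  · rw [hF]
    have := (hℓ p hp).1
    simp
    linarith
  rw [Om, Filter.Eventually, Filter.mem_iff_ultrafilter]
  intro U hU
  have hUf : ∀ᶠ x in (U : Filter E3), x ∈ frontier K := hU self_mem_nhdsWithin
  obtain ⟨N, hN, hNt⟩ := hB.exists_limit hν hp hU
  obtain ⟨k, k1, k2⟩ := hN.pick (ν 0 p)
  have hcN : ∀ {n : E3}, ⟪n, η p⟫ = 0 → c p ∈ pl (thru p n) := by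
    intro n hn
    rw [mem_thru, hc]
    simp only
    rw [inner_add_right, inner_smul_right, hn]; ring
  have e1 := (hNt k).eventually (NormalBody.eventually_meet (K := K) (A := thru p (ν 0 p))
        (hN.unit k) (hν.unit p hp 0) k1 k2
        ⟨c p, ⟨hcN (hN.orth k), hcN (hν.orth p hp 0)⟩, hcm⟩)
  show ∀ᶠ x in (U : Filter E3), F.ev x = 0
  filter_upwards [hUf, e1] with x hx hmeet
  obtain ⟨a, -, -, haf, -, hax, -, hap, -⟩ := hB.exists_two_common hmeet
  obtain ⟨o, r, h1⟩ := hB.sphere_of_allFlat hν hfl hp (hν.unit p hp 0) (hν.orth p hp 0)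
    (hν.ell p hp 0) hℓ
  obtain ⟨o', r', h2⟩ := hB.sphere_of_allFlat hν hfl hx (hν.unit x hx k) (hν.orth x hx k)
    (hν.ell x hx k) hℓ
  have a1 := h1 a haf hap
  have a2 := h2 a haf hax
  have p1 := h1 p hp (self_mem_thru p _)
  have x2 := h2 x hx (self_mem_thru x _)
  have hcx : c x = c p := by
    rw [hc]
    simp only
    rw [x2.2, p1.2, ← a1.2, ← a2.2]
  have hℓx : ℓ x / 2 = ℓ p / 2 := by rw [x2.1, p1.1, ← a1.1, ← a2.1]
  rw [hF]
  beta_reduce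
  rw [← hcx, hrad x hx, hℓx, sub_self]

end NormalBody

/-- A positive definite form becomes a multiple of the squared norm after a linear change of
coordinates. -/
theorem exists_linearEquiv_of_pos (B : E3 →L[ℝ] E3 →L[ℝ] ℝ) (hB : ∀ e, e ≠ 0 → 0 < B e e)
    {k : ℝ} (hk : 0 < k) : ∃ g : E3 ≃ₗ[ℝ] E3, ∀ y, B (g y) (g y) = k * ‖y‖ ^ 2 := by
  let Q : QuadraticForm ℝ E3 := LinearMap.BilinMap.toQuadraticMap (B.toLinearMap₁₂)
  have hQ : ∀ x, Q x = B x x := fun x => rfl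
  obtain ⟨w, ⟨T⟩⟩ := Q.equivalent_weightedSumSquares
  have hT : ∀ x, B (T.symm x) (T.symm x) = ∑ i, w i * x i ^ 2 := by
    intro x
    rw [← hQ, T.symm.map_app, QuadraticMap.weightedSumSquares_apply]
    simp [pow_two]
  have hw : ∀ i, 0 < w i := by
    intro i
    have h := hB (T.symm (Pi.single i 1)) (by
      rw [Ne, EmbeddingLike.map_eq_zero_iff]
      simp)
    rw [hT, Finset.sum_eq_single i] at h
    · simpa using h
    · intro j _ hj
      simp [hj]
    · simp
  have h3 : Module.finrank ℝ E3 = 3 := by simp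
  let f : E3 →ₗ[ℝ] E3 :=
    { toFun := fun y => T.symm fun i => √(k / w i) * y (finCongr h3 i)
      map_add' := fun x y => by
        rw [← map_add]
        congr 1
        ext i
        simp [mul_add]
      map_smul' := fun a x => by
        rw [RingHom.id_apply, ← map_smul]
        congr 1
        ext i
        simp
        ring }
  have hf : ∀ y, B (f y) (f y) = k * ‖y‖ ^ 2 := by
    intro y
    show B (T.symm fun i => √(k / w i) * y (finCongr h3 i)) (T.symm _) = _
    rw [hT, EuclideanSpace.norm_sq_eq, Finset.mul_sum, ← (finCongr h3).sum_comp]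
    refine Finset.sum_congr rfl fun i _ => ?_
    rw [mul_pow, Real.sq_sqrt (div_pos hk (hw i)).le, Real.norm_eq_abs, sq_abs]
    have := (hw i).ne'
    field_simp
  have hinj : Function.Injective f := by
    rw [injective_iff_map_eq_zero]
    intro y hy
    have := hf y
    rw [hy, map_zero] at this
    simpa [hk.ne'] using this.symm
  exact ⟨LinearEquiv.ofInjectiveEndo f hinj, hf⟩

theorem QF.exists_center (F : QF) (hB : ∀ e, e ≠ 0 → 0 < F.B e e) :
    ∃ c, ∀ v, F.ev (c + v) = F.ev c + F.B v v := by
  let L : E3 →ₗ[ℝ] E3 := ((InnerProductSpace.toDual ℝ E3).symm.toLinearEquiv.toLinearMap).comp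
    ((F.B + F.B.flip : E3 →L[ℝ] E3 →L[ℝ] ℝ) : E3 →ₗ[ℝ] E3 →L[ℝ] ℝ)
  have hL : ∀ x y, ⟪L x, y⟫ = F.B x y + F.B y x := by
    intro x y
    show ⟪(InnerProductSpace.toDual ℝ E3).symm _, y⟫ = _
    rw [InnerProductSpace.toDual_symm_apply]
    rfl
  have hinj : Function.Injective L := by
    rw [injective_iff_map_eq_zero]
    intro x hx
    by_contra hne
    have h1 := hL x x
    rw [hx, inner_zero_left] at h1
    linarith [hB x hne]
  obtain ⟨c, hc⟩ := LinearMap.surjective_of_injective hinj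
    (-(InnerProductSpace.toDual ℝ E3).symm F.l)
  refine ⟨c, fun v => ?_⟩
  have h1 := hL c v
  rw [hc, inner_neg_left, InnerProductSpace.toDual_symm_apply] at h1
  have h2 := F.ev_add_smul c v 1
  rw [F.D_apply, one_smul] at h2
  linarith

namespace NormalBody

variable {K : Set E3} {η : E3 → E3} {ν : Fin 2 → E3 → E3} {κ : ℝ}

theorem isPreconnected_frontier (hB : NormalBody K η) : IsPreconnected (frontier K) := by
  obtain ⟨φ, -, -, hφ⟩ := exists_homeomorph_image_interior_closure_frontier_eq_unitBall
    hB.convex hB.int hB.compact.isBounded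
  have hr : 1 < Module.rank ℝ E3 := by
    rw [← Module.finrank_eq_rank]
    simp
  have : frontier K = φ.symm '' Metric.sphere 0 1 := by
    rw [← hφ]
    exact (φ.toEquiv.symm_image_image _).symm
  rw [this]
  exact (isPreconnected_sphere hr 0 1).image _ φ.symm.continuous.continuousOn

theorem frontier_nonempty (hB : NormalBody K η) : (frontier K).Nonempty := by
  obtain ⟨m, hm⟩ := hB.int
  obtain ⟨e, he⟩ := exists_ne (0 : E3)
  obtain ⟨t, -, h⟩ := hB.exits hm he
  exact ⟨_, h⟩

theorem exists_om (hB : NormalBody K η) (hν : EllField K η ν κ) :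
    ∃ (F : QF) (m p : E3), m ∈ interior K ∧ F.ev m ≠ 0 ∧ p ∈ frontier K ∧ Om K F p := by
  by_contra! hno
  have hfl : AllFlat K η := fun p hp n hn hnp hE =>
    hB.om_or_all_flat hν hp (fun F m hm hF => hno F m p hm hF hp) hn hnp hE
  obtain ⟨p, hp⟩ := hB.frontier_nonempty
  obtain ⟨F, m, hm, hF, h⟩ := hB.om_of_allFlat hν hfl hp
  exact hno F m p hm hF hp h

theorem ev_eq_zero (hB : NormalBody K η) (hν : EllField K η ν κ) {F : QF} {p : E3}
    (hp : p ∈ frontier K) (h : Om K F p) : ∀ x ∈ frontier K, F.ev x = 0 := by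
  have hOm : ∀ x, Om K F x ↔ ∀ᶠ y in 𝓝 x, y ∈ frontier K → F.ev y = 0 := fun x =>
    eventually_nhdsWithin_iff
  have key := isPreconnected_iff_subset_of_disjoint.1 hB.isPreconnected_frontier
    {x | ∀ᶠ y in 𝓝 x, y ∈ frontier K → F.ev y = 0} {x | ∀ᶠ y in 𝓝 x, y ∈ frontier K → ¬ Om K F y}
    isOpen_setOfPred_eventually_nhds isOpen_setOfPred_eventually_nhds ?_ ?_
  · rcases key with key | key
    · exact fun x hx => (key hx : ∀ᶠ y in 𝓝 x, y ∈ frontier K → F.ev y = 0).self_of_nhds hx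
    · exact absurd h
        ((key hp : ∀ᶠ y in 𝓝 p, y ∈ frontier K → ¬ Om K F y).self_of_nhds hp)
  · intro x hx
    by_cases hxO : Om K F x
    · exact Or.inl ((hOm x).1 hxO)
    · right
      have := mt (hB.om_of_frequently hν hx) hxO
      rw [not_frequently] at this
      exact eventually_nhdsWithin_iff.1 this
  · rw [eq_empty_iff_forall_notMem]
    rintro x ⟨hx, h1, h2⟩
    exact h2.self_of_nhds hx ((hOm x).2 h1)

theorem isEllipsoid_of_ev (hB : NormalBody K η) {F : QF} {m : E3} (hm : m ∈ interior K)
    (hFm : F.ev m = -1) (hF : ∀ x ∈ frontier K, F.ev x = 0) : IsEllipsoid (frontier K) := by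
  have hroots : ∀ e : E3, e ≠ 0 → ∃ s t : ℝ, 0 < s ∧ 0 < t ∧ m + t • e ∈ frontier K ∧
      m + (-s) • e ∈ frontier K ∧ F.B e e * (s * t) = 1 ∧ F.D m e * (s * t) = s - t := by
    intro e he
    obtain ⟨t, ht, h1⟩ := hB.exits hm he
    obtain ⟨s, hs, h2⟩ := hB.exits hm (neg_ne_zero.2 he)
    rw [smul_neg, ← neg_smul] at h2
    have e1 := hF _ h1
    have e2 := hF _ h2
    rw [F.ev_add_smul, hFm] at e1 e2
    have hst : s + t ≠ 0 := by positivity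
    refine ⟨s, t, hs, ht, h1, h2, ?_, ?_⟩
    · apply mul_left_cancel₀ hst
      linear_combination s * e1 + t * e2
    · apply mul_left_cancel₀ hst
      linear_combination s ^ 2 * e1 - t ^ 2 * e2
  have hpos : ∀ e, e ≠ 0 → 0 < F.B e e := by
    intro e he
    obtain ⟨s, t, hs, ht, -, -, h, -⟩ := hroots e he
    by_contra! hle
    nlinarith [mul_pos hs ht]
  have hzero : ∀ x, F.ev x = 0 → x ∈ frontier K := by
    intro x hx
    have hne : x - m ≠ 0 := by
      intro h
      rw [sub_eq_zero.1 h, hFm] at hx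
      norm_num at hx
    obtain ⟨s, t, hs, ht, h1, h2, h3, h4⟩ := hroots _ hne
    have h5 := F.ev_add_smul m (x - m) 1
    rw [one_smul, add_sub_cancel, hx, hFm] at h5
    have h6 : (1 - t) * (1 + s) = 0 := by
      linear_combination (-(s * t)) * h5 + (-1 : ℝ) * h3 - h4
    have h7 : t = 1 := by
      rcases mul_eq_zero.1 h6 with h | h <;> linarith
    rwa [h7, one_smul, add_sub_cancel] at h1
  obtain ⟨c, hc⟩ := F.exists_center hpos
  have hcm := hc (m - c)
  rw [add_sub_cancel, hFm] at hcm
  have hk : 0 < -F.ev c := by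
    by_cases h : m - c = 0
    · rw [h, map_zero] at hcm
      linarith
    · linarith [hpos _ h]
  obtain ⟨g, hg⟩ := exists_linearEquiv_of_pos F.B hpos hk
  refine ⟨g.toAffineEquiv.trans (AffineEquiv.constVAdd ℝ E3 c), ?_⟩
  have hval : ∀ y, F.ev (c + g y) = -F.ev c * (‖y‖ ^ 2 - 1) := fun y => by
    rw [hc, hg]
    ring
  ext x
  constructor
  · intro hx
    refine ⟨g.symm (x - c), ?_, by simp⟩
    have h1 := hval (g.symm (x - c))
    rw [g.apply_symm_apply, add_sub_cancel, hF x hx] at h1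
    have h2 := (mul_eq_zero.1 h1.symm).resolve_left hk.ne'
    rw [mem_sphere_zero_iff_norm]
    have h3 := norm_nonneg (g.symm (x - c))
    nlinarith
  · rintro ⟨y, hy, rfl⟩
    rw [mem_sphere_zero_iff_norm] at hy
    apply hzero
    show F.ev (c + g y) = 0
    rw [hval, hy]
    norm_num

theorem isEllipsoid (hB : NormalBody K η) (hν : EllField K η ν κ) : IsEllipsoid (frontier K) := by
  obtain ⟨F, m, p, hm, hFm, hp, h⟩ := hB.exists_om hν
  have hF := hB.ev_eq_zero hν hp h
  obtain ⟨G, hG⟩ := (IsQuad.of_ev F).smul (-(F.ev m)⁻¹)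
  refine hB.isEllipsoid_of_ev (F := G) hm ?_ fun x hx => ?_
  · rw [hG]
    field_simp
  · rw [hG]
    beta_reduce
    rw [hF x hx, mul_zero]

end NormalBody

theorem eq_pl_thru {H : Set E3} {n p e : E3} (hH : IsPlaneWithNormal H n)
    (h : lineThrough p e ⊆ H) : ⟪n, e⟫ = 0 ∧ H = pl (thru p n) := by
  obtain ⟨-, c, rfl⟩ := hH
  have h0 : ⟪n, p⟫ = c := h ⟨0, by simp⟩
  have h1 : ⟪n, p + (1 : ℝ) • e⟫ = c := h ⟨1, rfl⟩
  rw [one_smul, inner_add_right, h0] at h1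
  refine ⟨by linarith, ?_⟩
  ext x
  rw [mem_thru, h0]
  rfl

end

/-- If through every boundary point of a smooth strictly convex body
there are two elliptic normal sections making an angle at least `α`, then the boundary
is an ellipsoid. -/
theorem two_normal_elliptic_sections_ellipsoid (K : Set E3) (hK : IsConvexBody K)
    (hsm : IsSmoothBody K) (hsc : IsStrictlyConvexBody K)
    (η : E3 → E3) (hη : IsOuterNormal K η) (α : ℝ) (hα : 0 < α)
    (h : ∀ p ∈ frontier K, ∃ (H₁ H₂ : Set E3) (n₁ n₂ : E3),
      IsPlaneWithNormal H₁ n₁ ∧ IsPlaneWithNormal H₂ n₂ ∧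
      lineThrough p (η p) ⊆ H₁ ∧ lineThrough p (η p) ⊆ H₂ ∧
      α ≤ Real.arccos |⟪n₁, n₂⟫| ∧
      IsEllipse (frontier K ∩ H₁) ∧ IsEllipse (frontier K ∩ H₂)) :
    IsEllipsoid (frontier K) := by
  have hB : NormalBody K η := ⟨hK.1, hK.2.1, hK.2.2, hsm, hsc, hη⟩
  have hex : ∀ p, ∃ n : Fin 2 → E3, p ∈ frontier K → (∀ i, ‖n i‖ = 1) ∧ (∀ i, ⟪n i, η p⟫ = 0) ∧
      α ≤ Real.arccos |⟪n 0, n 1⟫| ∧ ∀ i, IsEllipse (frontier K ∩ pl (thru p (n i))) := by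
    intro p
    by_cases hp : p ∈ frontier K
    · obtain ⟨H₁, H₂, n₁, n₂, h1, h2, l1, l2, ha, e1, e2⟩ := h p hp
      obtain ⟨o1, rfl⟩ := eq_pl_thru h1 l1
      obtain ⟨o2, rfl⟩ := eq_pl_thru h2 l2
      refine ⟨![n₁, n₂], fun _ => ⟨?_, ?_, ha, ?_⟩⟩
      · exact Fin.forall_fin_two.2 ⟨h1.1, h2.1⟩
      · exact Fin.forall_fin_two.2 ⟨o1, o2⟩
      · exact Fin.forall_fin_two.2 ⟨e1, e2⟩
    · exact ⟨0, fun hp' => absurd hp' hp⟩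
  choose n hn using hex
  obtain ⟨q, hq⟩ := hB.frontier_nonempty
  have hαπ : α ≤ Real.pi := (hn q hq).2.2.1.trans (Real.arccos_le_pi _)
  refine hB.isEllipsoid (ν := fun i p => n p i) (κ := Real.cos α)
    ⟨?_, fun p hp => (hn p hp).1, fun p hp => (hn p hp).2.1, fun p hp => ?_,
      fun p hp => (hn p hp).2.2.2⟩
  · rw [← Real.cos_zero]
    exact Real.cos_lt_cos_of_nonneg_of_le_pi le_rfl hαπ hα
  · have hc : |⟪n p 0, n p 1⟫| ≤ 1 := by
      have := abs_real_inner_le_norm (n p 0) (n p 1)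
      rwa [(hn p hp).1, (hn p hp).1, one_mul] at this
    rw [← Real.cos_arccos (by linarith [abs_nonneg ⟪n p 0, n p 1⟫]) hc]
    exact Real.cos_le_cos_of_nonneg_of_le_pi hα.le (Real.arccos_le_pi _) (hn p hp).2.2.1
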